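/- Let n > 8, let S̃_n be Schur's double cover of S_n with projection π, and let (ρ, V) be an irreducible spin representation of S̃_n with dim_ℂ V = 2^{⌊(n−1)/2⌋} (a basic spin representation). Let g ∈ S̃_n with k = k(g) the order of π(g), and assume that 5 IS a solitary part of the cycle type of π(g) while 3 is NOT a solitary part of the cycle type of π(g). Then 5 divides k and the minimal polynomial p(X) of ρ(g) satisfies p(X) · (X^{k/5} − ε_g) = X^k − ε_g. -/

import Mathlib

/-!
Schur's double cover `S̃_N` of the symmetric group, presented by generators
`z, t_1, …, t_{N-1}` and relations `z² = 1`, `t_i² = z`, `(t_i t_{i+1})³ = z`,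
`(t_i t_j)² = z` for `|i − j| ≥ 2`.

Generators are indexed by `Option (Fin (N-1))`: `none` is the central element `z`
and `some i` is `t_{i+1}` (so `some i` for `i = 0, …, N-2` are `t_1, …, t_{N-1}`).
-/

abbrev SchurGen (N : ℕ) := Option (Fin (N - 1))

namespace Schur

/-- The relator `z` as an element of the free group. -/
def zf (N : ℕ) : FreeGroup (SchurGen N) := FreeGroup.of none

/-- The generator `t_{i+1}` as an element of the free group. -/
def tf (N : ℕ) (i : Fin (N - 1)) : FreeGroup (SchurGen N) := FreeGroup.of (some i)

/-- The defining relators of Schur's double cover. -/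
def rels (N : ℕ) : Set (FreeGroup (SchurGen N)) :=
  { r | r = zf N ^ 2 ∨
        (∃ i, r = tf N i ^ 2 * (zf N)⁻¹) ∨
        (∃ i j : Fin (N - 1), (i : ℕ) + 1 = (j : ℕ) ∧
          r = (tf N i * tf N j) ^ 3 * (zf N)⁻¹) ∨
        (∃ i j : Fin (N - 1), ((i : ℕ) + 2 ≤ (j : ℕ) ∨ (j : ℕ) + 2 ≤ (i : ℕ)) ∧
          r = (tf N i * tf N j) ^ 2 * (zf N)⁻¹) }

/-- Schur's double cover `S̃_N` of the symmetric group `S_N`. -/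
abbrev Cover (N : ℕ) := PresentedGroup (rels N)

/-- The central element `z` of `S̃_N`. -/
def z (N : ℕ) : Cover N := PresentedGroup.of none

/-- The generator `t_{i+1}` of `S̃_N` (0-indexed). -/
def t (N : ℕ) (i : Fin (N - 1)) : Cover N := PresentedGroup.of (some i)

/-- The generator `t_i` of `S̃_N`, 1-indexed: meaningful for `1 ≤ i ≤ N-1`
(junk value `1` outside this range). -/
def T (N i : ℕ) : Cover N := if h : i - 1 < N - 1 then t N ⟨i - 1, h⟩ else 1

/-- The product `t_a t_{a+1} ⋯ t_{a+n-1}` (`n` consecutive generators, 1-indexed). -/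
def P (N a n : ℕ) : Cover N := ((List.range n).map fun j => T N (a + j)).prod

end Schur


/-- The adjacent transposition `(i, i+1)` of `{1, …, n}`: in 0-indexed terms, for
`i : Fin (n-1)` this is the swap of `i` and `i+1` in `Fin n`.  It is the image of the
generator `t_{i+1}` under the canonical projection `S̃_n → S_n`. -/
def Schur.adj (n : ℕ) (i : Fin (n - 1)) : Equiv.Perm (Fin n) :=
  Equiv.swap ⟨i.1, by have := i.2; omega⟩ ⟨i.1 + 1, by have := i.2; omega⟩

/-- `d` is a *solitary part* of the cycle type of a permutation `σ` if exactly one cycle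
of `σ` has length divisible by `d` and this cycle has length `d` (fixed points count as
cycles of length 1; for `d = 3, 5` these never have length divisible by `d`, so Mathlib's
`cycleType`, which omits fixed points, captures the condition). -/
def Schur.SolitaryPart (d : ℕ) {α : Type*} [Fintype α] [DecidableEq α]
    (σ : Equiv.Perm α) : Prop :=
  σ.cycleType.filter (fun l => d ∣ l) = {d}

section

open Module

/-- `s 0, …, s (n - 2)` satisfy the relations of the twisted group algebra of `S_n`. -/
structure IsSpin {R : Type*} [Ring R] (n : ℕ) (s : ℕ → R) : Prop where
  sq : ∀ i, i + 1 < n → s i * s i = 1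
  braid : ∀ i, i + 2 < n → s i * s (i + 1) * s i = s (i + 1) * s i * s (i + 1)
  anti : ∀ i j, i + 2 ≤ j → j + 1 < n → s i * s j = -(s j * s i)

namespace IsSpin

/-- The spin Jucys–Murphy elements. -/
def jm {R : Type*} [Ring R] (s : ℕ → R) : ℕ → R
  | 0 => 0
  | k + 1 => s k - s k * jm s k * s k

section Ring

variable {R : Type*} [Ring R] {n : ℕ} {s : ℕ → R}

theorem mono (h : IsSpin n s) {m : ℕ} (hm : m ≤ n) : IsSpin m s where
  sq i hi := h.sq i (by omega)
  braid i hi := h.braid i (by omega)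
  anti i j hij hj := h.anti i j hij (by omega)

theorem anti' (h : IsSpin n s) {i j : ℕ} (hi : i + 1 < n) (hj : j + 1 < n)
    (hij : i + 2 ≤ j ∨ j + 2 ≤ i) : s i * s j = -(s j * s i) := by
  rcases hij with hij | hij
  · exact h.anti i j hij hj
  · rw [h.anti j i hij hi, neg_neg]

theorem jm_succ (k : ℕ) : jm s (k + 1) = s k - s k * jm s k * s k := rfl

theorem mul_jm_add (h : IsSpin n s) {k : ℕ} (hk : k + 1 < n) :
    s k * jm s k + jm s (k + 1) * s k = 1 := by
  have h1 := h.sq k hk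
  rw [jm_succ]
  linear_combination (norm := noncomm_ring) h1 - s k * jm s k * h1

theorem jm_succ_mul (h : IsSpin n s) {k : ℕ} (hk : k + 1 < n) :
    s k * jm s (k + 1) + jm s k * s k = 1 := by
  have h1 := h.sq k hk
  rw [jm_succ]
  linear_combination (norm := noncomm_ring) h1 - h1 * jm s k * s k

theorem jm_anti_of_anti {A : R} : ∀ {j : ℕ}, (∀ i < j, s i * A = -(A * s i)) →
    jm s j * A = -(A * jm s j)
  | 0, _ => by simp [jm]
  | j + 1, hA => by
    have ih := jm_anti_of_anti (j := j) fun i hi => hA i (by omega)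
    have h1 := hA j (by omega)
    rw [jm_succ]
    linear_combination (norm := noncomm_ring) h1 - s j * jm s j * h1 + s j * ih * s j
      - h1 * jm s j * s j

theorem jm_anti_of_le (h : IsSpin n s) {j k : ℕ} (hkj : k + 1 ≤ j) (hj : j + 1 < n) :
    s j * jm s k = -(jm s k * s j) := by
  rw [jm_anti_of_anti (A := s j) fun i hi => h.anti i j (by omega) hj, neg_neg]

theorem jm_anti_of_lt (h : IsSpin n s) {j k : ℕ} (hjk : j + 1 < k) (hk : k < n) :
    s j * jm s k = -(jm s k * s j) := by
  induction k with
  | zero => omega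
  | succ k ih =>
    rcases Nat.lt_or_ge (j + 1) k with hlt | hge
    · have ih := ih hlt (by omega)
      have h1 := h.anti j k (by omega) hk
      rw [jm_succ]
      linear_combination (norm := noncomm_ring) h1 - h1 * jm s k * s k + s k * ih * s k
        - s k * jm s k * h1
    · obtain rfl : k = j + 1 := by omega
      have hx := h.jm_anti_of_le (j := j + 1) (k := j) le_rfl hk
      have hb := h.braid j hk
      have ha := h.sq j (by omega)
      have hbb := h.sq (j + 1) hk
      rw [jm_succ, jm_succ]
      generalize s j = a at *
      generalize s (j + 1) = b at *
      generalize jm s j = x at *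
      have e1 : a * b * a * b = b * a := by
        rw [hb, mul_assoc, hbb, mul_one]
      have e2 : b * a * b * a = a * b := by
        rw [← hb, mul_assoc, ha, mul_one]
      have e3 : a * (b * (a * x * a) * b) = -(b * (a * x * a) * b * a) := by
        have l : a * (b * (a * x * a) * b) = -(b * a * x * (b * a * b)) := by
          calc a * (b * (a * x * a) * b) = (a * b * a) * x * a * b := by noncomm_ring
            _ = b * a * (b * x) * a * b := by rw [hb]; noncomm_ring
            _ = _ := by rw [hx]; noncomm_ring
        rw [l, ← hb]; noncomm_ring
      linear_combination (norm := noncomm_ring) e3 - e1 - e2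

theorem jm_anti_jm (h : IsSpin n s) {j k : ℕ} (hjk : j < k) (hk : k < n) :
    jm s j * jm s k = -(jm s k * jm s j) :=
  jm_anti_of_anti fun i hi => h.jm_anti_of_lt (by omega) hk

theorem sq_jm_comm (h : IsSpin n s) {j k : ℕ} (hj : j < n) (hk : k < n) :
    Commute (jm s j * jm s j) (jm s k) := by
  rcases lt_trichotomy j k with hlt | rfl | hlt
  · have := h.jm_anti_jm hlt hk
    show _ = _
    linear_combination (norm := noncomm_ring) jm s j * this - this * jm s j
  · exact mul_assoc _ _ _
  · have := h.jm_anti_jm hlt hj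
    show _ = _
    linear_combination (norm := noncomm_ring) jm s j * this - this * jm s j

theorem sq_jm_comm_of_ne (h : IsSpin n s) {j k : ℕ} (hj : j + 1 < n) (hk : k < n)
    (h1 : k ≠ j) (h2 : k ≠ j + 1) : Commute (s j) (jm s k * jm s k) := by
  have : s j * jm s k = -(jm s k * s j) := by
    rcases Nat.lt_or_ge k j with hlt | hge
    · exact h.jm_anti_of_le hlt hj
    · exact h.jm_anti_of_lt (by omega) hk
  show _ = _
  linear_combination (norm := noncomm_ring) this * jm s k - jm s k * this

theorem sq_jm_mul (h : IsSpin n s) {k : ℕ} (hk : k + 1 < n) :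
    jm s k * jm s k * s k =
      s k * (jm s (k + 1) * jm s (k + 1)) + (jm s k - jm s (k + 1)) := by
  have h1 := h.mul_jm_add hk
  have h2 := h.jm_succ_mul hk
  linear_combination (norm := noncomm_ring) jm s k * h2 - h2 * jm s (k + 1)

theorem sq_jm_succ_mul (h : IsSpin n s) {k : ℕ} (hk : k + 1 < n) :
    jm s (k + 1) * jm s (k + 1) * s k =
      s k * (jm s k * jm s k) - (jm s k - jm s (k + 1)) := by
  have h1 := h.mul_jm_add hk
  linear_combination (norm := noncomm_ring) jm s (k + 1) * h1 - h1 * jm s k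

/-- The sum of the squares of the Jucys–Murphy elements. -/
theorem sum_sq_jm_comm (h : IsSpin n s) {j : ℕ} (hj : j + 1 < n) :
    Commute (s j) (∑ k ∈ Finset.range n, jm s k * jm s k) := by
  have hj1 : j ∈ Finset.range n := by simp; omega
  have hj2 : j + 1 ∈ (Finset.range n).erase j := by simp; omega
  rw [← Finset.add_sum_erase _ _ hj1, ← Finset.add_sum_erase _ _ hj2, ← add_assoc]
  refine Commute.add_right ?_ (Commute.sum_right _ _ _ fun k hk => ?_)
  · have h1 := h.sq_jm_mul hj
    have h2 := h.sq_jm_succ_mul hj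
    show _ = _
    linear_combination (norm := noncomm_ring) -h1 - h2
  · simp at hk
    exact h.sq_jm_comm_of_ne hj hk.2.2 hk.2.1 hk.1

end Ring

end IsSpin

section LinearAlgebra

variable {V : Type*} [AddCommGroup V] [Module ℂ V] [FiniteDimensional ℂ V]

theorem exists_eigenvector_mem {U : Submodule ℂ V} (hU : U ≠ ⊥) {A : End ℂ V}
    (hA : ∀ v ∈ U, A v ∈ U) : ∃ μ : ℂ, ∃ v ∈ U, v ≠ 0 ∧ A v = μ • v := by
  have := Submodule.nontrivial_iff_ne_bot.2 hU
  obtain ⟨μ, hμ⟩ := End.exists_eigenvalue (A.restrict hA)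
  obtain ⟨v, hv⟩ := hμ.exists_hasEigenvector
  refine ⟨μ, v, v.2, fun h => hv.2 (Subtype.ext h), ?_⟩
  simpa using congrArg Subtype.val hv.apply_eq_smul

theorem exists_common_eigenvector_mem {A : ℕ → End ℂ V} (hA : ∀ i j, Commute (A i) (A j)) (n : ℕ)
    {U : Submodule ℂ V} (hU : U ≠ ⊥) (hAU : ∀ i, ∀ v ∈ U, A i v ∈ U) :
    ∃ μ : ℕ → ℂ, ∃ v ∈ U, v ≠ 0 ∧ ∀ i < n, A i v = μ i • v := by
  induction n generalizing U with
  | zero =>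
    obtain ⟨v, hv, hv0⟩ := U.ne_bot_iff.1 hU
    exact ⟨0, v, hv, hv0, by simp⟩
  | succ n ih =>
    obtain ⟨ν, v, hv, hv0, hve⟩ := exists_eigenvector_mem hU (hAU n)
    have hne : U ⊓ LinearMap.ker (A n - ν • 1) ≠ ⊥ :=
      (Submodule.ne_bot_iff _).2 ⟨v, ⟨hv, by simp [hve]⟩, hv0⟩
    obtain ⟨μ, w, hw, hw0, hwe⟩ := ih hne fun i w hw => by
      refine ⟨hAU i w hw.1, ?_⟩
      have h1 : A n w = ν • w := by
        have := hw.2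
        simpa [sub_eq_zero] using this
      have h2 : A n (A i w) = A i (A n w) := congrArg (· w) (hA n i).eq
      simp [h2, h1]
    refine ⟨Function.update μ n ν, w, hw.1, hw0, fun i hi => ?_⟩
    rcases Nat.lt_succ_iff_lt_or_eq.1 hi with hlt | rfl
    · simpa [hlt.ne] using hwe i hlt
    · have := hw.2
      simpa [sub_eq_zero] using this

theorem finrank_eq_two_mul_finrank_inf_ker {U : Submodule ℂ V} {A B : End ℂ V}
    (hAU : ∀ v ∈ U, A v ∈ U) (hBU : ∀ v ∈ U, B v ∈ U) {a b : ℂ} (ha : a ≠ 0) (hb : b ≠ 0)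
    (hA : A * A = (a * a) • 1) (hB : B * B = b • 1) (hAB : A * B = -(B * A)) :
    finrank ℂ U = 2 * finrank ℂ (U ⊓ LinearMap.ker (A - a • 1) : Submodule ℂ V) := by
  have hA' v : A (A v) = (a * a) • v := congrArg (· v) hA
  have hB' v : B (B v) = b • v := congrArg (· v) hB
  have hAB' v : A (B v) = -B (A v) := congrArg (· v) hAB
  set P := U ⊓ LinearMap.ker (A - a • 1)
  set M := U ⊓ LinearMap.ker (A + a • 1)
  have hP v : v ∈ P ↔ v ∈ U ∧ A v = a • v := by simp [P, sub_eq_zero]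
  have hM v : v ∈ M ↔ v ∈ U ∧ A v = -(a • v) := by simp [M, add_eq_zero_iff_eq_neg]
  have hinj : Function.Injective B := by
    refine (injective_iff_map_eq_zero B).2 fun v hv => ?_
    have := hB' v
    rw [hv, map_zero] at this
    exact (smul_eq_zero.1 this.symm).resolve_left hb
  have hmap : P.map B = M := by
    ext v
    rw [Submodule.mem_map, hM]
    constructor
    · rintro ⟨u, hu, rfl⟩
      rw [hP] at hu
      exact ⟨hBU u hu.1, by rw [hAB', hu.2, map_smul]⟩
    · rintro ⟨hv, hva⟩
      refine ⟨b⁻¹ • B v, ?_, ?_⟩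
      · rw [hP]
        refine ⟨U.smul_mem _ (hBU v hv), ?_⟩
        rw [map_smul, hAB', hva, map_neg, neg_neg, map_smul, smul_comm]
      · rw [map_smul, hB', smul_smul, inv_mul_cancel₀ hb, one_smul]
  have h1 : finrank ℂ M = finrank ℂ P := by
    rw [← hmap]
    exact (LinearEquiv.finrank_eq (Submodule.equivMapOfInjective B hinj P)).symm
  have hsup : P ⊔ M = U := by
    refine le_antisymm (sup_le inf_le_left inf_le_left) fun v hv => ?_
    have e : v = (2 * a)⁻¹ • (a • v + A v) + (2 * a)⁻¹ • (a • v - A v) := by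
      rw [← smul_add, add_add_sub_cancel, ← add_smul, smul_smul, ← two_mul, inv_mul_cancel₀,
        one_smul]
      simpa using ha
    rw [e]
    refine Submodule.add_mem_sup (P.smul_mem _ ?_) (M.smul_mem _ ?_)
    · rw [hP]
      refine ⟨U.add_mem (U.smul_mem _ hv) (hAU v hv), ?_⟩
      rw [map_add, map_smul, hA', mul_smul, smul_add, add_comm]
    · rw [hM]
      refine ⟨U.sub_mem (U.smul_mem _ hv) (hAU v hv), ?_⟩
      rw [map_sub, map_smul, hA', mul_smul, smul_sub, neg_sub]
  have hinf : P ⊓ M = ⊥ := by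
    refine (Submodule.eq_bot_iff _).2 fun v hv => ?_
    have h1 := ((hP v).1 hv.1).2
    have h2 := ((hM v).1 hv.2).2
    have : (2 * a) • v = 0 := by
      rw [two_mul, add_smul]
      exact add_eq_zero_iff_eq_neg.2 (h1.symm.trans h2)
    exact (smul_eq_zero.1 this).resolve_left (by simpa using ha)
  have := Submodule.finrank_sup_add_finrank_inf_eq P M
  rw [hsup, hinf, finrank_bot, h1] at this
  omega

theorem two_pow_le_finrank_of_anticomm {U : Submodule ℂ V} (hU : U ≠ ⊥) (m : ℕ)
    {e : ℕ → End ℂ V} (he : ∀ i < 2 * m, ∃ c : ℂ, c ≠ 0 ∧ e i * e i = c • 1)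
    (hanti : ∀ j < 2 * m, ∀ i < j, e i * e j = -(e j * e i))
    (heU : ∀ i < 2 * m, ∀ v ∈ U, e i v ∈ U) : 2 ^ m ≤ finrank ℂ U := by
  induction m generalizing U with
  | zero =>
    have := Submodule.nontrivial_iff_ne_bot.2 hU
    exact finrank_pos (R := ℂ) (M := U)
  | succ m ih =>
    obtain ⟨c, hc, hcc⟩ := he (2 * m) (by omega)
    obtain ⟨c', hc', hcc'⟩ := he (2 * m + 1) (by omega)
    have hx := hanti (2 * m + 1) (by omega) (2 * m) (by omega)
    obtain ⟨a, ha⟩ := IsAlgClosed.exists_eq_mul_self (-(c * c'))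
    have ha0 : a ≠ 0 := by
      rintro rfl
      rw [zero_mul, neg_eq_zero, mul_eq_zero] at ha
      exact ha.elim hc hc'
    have hfin := finrank_eq_two_mul_finrank_inf_ker (U := U)
      (A := e (2 * m) * e (2 * m + 1)) (B := e (2 * m)) (a := a) (b := c)
      (fun v hv => heU _ (by omega) _ (heU _ (by omega) v hv)) (heU _ (by omega)) ha0 hc
      (by
        rw [← ha]
        calc _ = e (2 * m) * (e (2 * m + 1) * e (2 * m)) * e (2 * m + 1) := by noncomm_ring
          _ = -((e (2 * m) * e (2 * m)) * (e (2 * m + 1) * e (2 * m + 1))) := by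
            rw [← neg_eq_iff_eq_neg.2 hx]; noncomm_ring
          _ = _ := by rw [hcc, hcc']; simp [smul_smul, mul_comm])
      hcc
      (by rw [mul_assoc, ← neg_eq_iff_eq_neg.2 hx]; noncomm_ring)
    have hU' : U ⊓ LinearMap.ker (e (2 * m) * e (2 * m + 1) - a • 1) ≠ ⊥ := by
      intro h
      rw [h, finrank_bot, mul_zero, Submodule.finrank_eq_zero] at hfin
      exact hU hfin
    have := ih hU' (fun i hi => he i (by omega)) (fun j hj => hanti j (by omega))
      fun i hi v hv => by
        refine ⟨heU i (by omega) v hv.1, ?_⟩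
        have h1 : e i * (e (2 * m) * e (2 * m + 1)) = (e (2 * m) * e (2 * m + 1)) * e i := by
          rw [← mul_assoc, hanti (2 * m) (by omega) i hi, neg_mul, mul_assoc,
            hanti (2 * m + 1) (by omega) i (by omega), mul_neg, neg_neg, mul_assoc]
        have h2 : e (2 * m) (e (2 * m + 1) (e i v)) = e i (e (2 * m) (e (2 * m + 1) v)) :=
          (congrArg (· v) h1).symm
        have h3 := hv.2
        rw [SetLike.mem_coe, LinearMap.mem_ker, LinearMap.sub_apply, sub_eq_zero] at h3 ⊢
        simp only [End.mul_apply, LinearMap.smul_apply, End.one_apply] at h3 ⊢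
        rw [h2, h3, map_smul]
    rw [hfin, pow_succ]
    omega

theorem three_mul_finrank_ker_sub_one {c : End ℂ V} (hc : c ^ 3 = 1) :
    3 * (finrank ℂ (LinearMap.ker (c - 1)) : ℂ) =
      finrank ℂ V + LinearMap.trace ℂ V c + LinearMap.trace ℂ V (c ^ 2) := by
  have hproj : LinearMap.IsProj (LinearMap.ker (c - 1)) ((3⁻¹ : ℂ) • (1 + c + c ^ 2)) := by
    constructor
    · intro v
      have : (c - 1) * (1 + c + c ^ 2) = 0 := by
        linear_combination (norm := noncomm_ring) hc
      have := congrArg (· v) this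
      rw [LinearMap.mem_ker, LinearMap.smul_apply, map_smul]
      exact smul_eq_zero.2 (Or.inr this)
    · intro v hv
      have h1 : c v = v := by simpa [sub_eq_zero] using hv
      have : (1 + c + c ^ 2 : End ℂ V) v = (3 : ℂ) • v := by
        simp only [LinearMap.add_apply, End.one_apply, pow_two, End.mul_apply, h1]
        module
      rw [LinearMap.smul_apply, this, smul_smul, inv_mul_cancel₀ (by norm_num), one_smul]
  have := hproj.trace
  rw [map_smul, map_add, map_add, LinearMap.trace_one, smul_eq_mul] at this
  rw [← this]
  ring

end LinearAlgebra

namespace IsSpin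

section Ring

variable {R : Type*} [Ring R] {n : ℕ} {s : ℕ → R}

theorem cube_mul_succ (h : IsSpin n s) {i : ℕ} (hi : i + 2 < n) : (s i * s (i + 1)) ^ 3 = 1 := by
  have h1 := h.sq i (by omega)
  have h2 := h.sq (i + 1) hi
  have h3 := h.braid i hi
  linear_combination (norm := noncomm_ring) h3 * s (i + 1) * s i * s (i + 1)
    + s (i + 1) * s i * h2 * s i * s (i + 1) + s (i + 1) * h1 * s (i + 1) + h2

theorem mul_mul_eq_one (h : IsSpin n s) {i : ℕ} (hi : i + 3 < n) :
    s i * s (i + 1) * s (i + 2) * (s (i + 2) * s (i + 1) * s i) = 1 := by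
  have h1 := h.sq i (by omega)
  have h2 := h.sq (i + 1) (by omega)
  have h3 := h.sq (i + 2) (by omega)
  linear_combination (norm := noncomm_ring) s i * s (i + 1) * h3 * s (i + 1) * s i
    + s i * h2 * s i + h1

theorem mul_mul_eq_one' (h : IsSpin n s) {i : ℕ} (hi : i + 3 < n) :
    s (i + 2) * s (i + 1) * s i * (s i * s (i + 1) * s (i + 2)) = 1 := by
  have h1 := h.sq i (by omega)
  have h2 := h.sq (i + 1) (by omega)
  have h3 := h.sq (i + 2) (by omega)
  linear_combination (norm := noncomm_ring) s (i + 2) * s (i + 1) * h1 * s (i + 1) * s (i + 2)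
    + s (i + 2) * h2 * s (i + 2) + h3

theorem mul_mul_conj (h : IsSpin n s) {i : ℕ} (hi : i + 3 < n) :
    s i * s (i + 1) * s (i + 2) * (s i * s (i + 1)) =
      s (i + 1) * s (i + 2) * (s i * s (i + 1) * s (i + 2)) := by
  have h1 := h.braid i (by omega)
  have h2 : s (i + 1) * s (i + 2) * s (i + 1) = s (i + 2) * s (i + 1) * s (i + 2) :=
    h.braid (i + 1) hi
  have h3 := h.anti i (i + 2) le_rfl hi
  linear_combination (norm := noncomm_ring) s i * s (i + 1) * h3 * s (i + 1)
    - h1 * s (i + 2) * s (i + 1) - s (i + 1) * s i * h2 - s (i + 1) * h3 * s (i + 1) * s (i + 2)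

theorem succ_mul_add (h : IsSpin n s) (h0 : s 0 * s 1 + s 1 * s 0 = -1) {i : ℕ}
    (hi : i + 2 < n) : s i * s (i + 1) + s (i + 1) * s i = -1 := by
  induction i with
  | zero => simpa using h0
  | succ i ih =>
    have ih := ih (by omega)
    have h1 := h.mul_mul_eq_one hi
    have h2 := h.mul_mul_conj hi
    have h3 := h.sq i (by omega)
    have h4 := h.sq (i + 1) (by omega)
    have h5 := h.sq (i + 2) (by omega)
    have h6 := h.mul_mul_eq_one' hi
    set g := s i * s (i + 1) * s (i + 2) with hg
    set g' := s (i + 2) * s (i + 1) * s i with hg'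
    have e1 : s (i + 1) * s (i + 2) = g * (s i * s (i + 1)) * g' := by
      rw [h2, mul_assoc, h1, mul_one]
    have e2 : s (i + 2) * s (i + 1) = g * (s (i + 1) * s i) * g' := by
      have : s (i + 2) * s (i + 1) * (s (i + 1) * s (i + 2)) = 1 := by
        linear_combination (norm := noncomm_ring) s (i + 2) * h4 * s (i + 2) + h5
      calc s (i + 2) * s (i + 1) = s (i + 2) * s (i + 1) * (g * (s i * s (i + 1)) *
            (s (i + 1) * s i) * g') := by
            linear_combination (norm := noncomm_ring) - s (i + 2) * s (i + 1) * h1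
              - s (i + 2) * s (i + 1) * g * s i * h4 * s i * g'
              - s (i + 2) * s (i + 1) * g * h3 * g'
        _ = _ := by
            rw [h2]
            linear_combination (norm := noncomm_ring) this * g * s (i + 1) * s i * g'
    show s (i + 1) * s (i + 2) + s (i + 2) * s (i + 1) = -1
    rw [e1, e2]
    linear_combination (norm := noncomm_ring) g * ih * g' - h1

theorem jm_mul_add_of_basic (h : IsSpin n s)
    (hb : ∀ i, i + 2 < n → s i * s (i + 1) + s (i + 1) * s i = -1) :
    ∀ {k : ℕ}, k + 1 < n → s k * jm s k + jm s k * s k = -(k : R)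
  | 0, _ => by simp [jm]
  | k + 1, hk => by
    have ih := h.jm_mul_add_of_basic hb (k := k) (by omega)
    have h1 := hb k hk
    have h2 := h.jm_anti_of_le (j := k + 1) (k := k) le_rfl hk
    have h3 := h.sq k (by omega)
    have e : jm s (k + 1) = (k + 1) * s k + jm s k := by
      rw [jm_succ]
      linear_combination (norm := noncomm_ring) -ih * s k + jm s k * h3
    have hc : (k : R) * s (k + 1) = s (k + 1) * k := (Nat.cast_commute _ _).eq
    push_cast
    rw [e]
    linear_combination (norm := noncomm_ring) h2 + h1 + k * h1 - hc * s k
 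
theorem jm_succ_of_basic (h : IsSpin n s)
    (hb : ∀ i, i + 2 < n → s i * s (i + 1) + s (i + 1) * s i = -1) {k : ℕ} (hk : k + 1 < n) :
    jm s (k + 1) = (k + 1) * s k + jm s k := by
  have ih := h.jm_mul_add_of_basic hb hk
  have h3 := h.sq k (by omega)
  rw [jm_succ]
  linear_combination (norm := noncomm_ring) -ih * s k + jm s k * h3

theorem jm_sq_of_basic (h : IsSpin n s)
    (hb : ∀ i, i + 2 < n → s i * s (i + 1) + s (i + 1) * s i = -1) :
    ∀ {k : ℕ}, k < n → 2 * (jm s k * jm s k) = ((k * (k + 1) : ℕ) : R)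
  | 0, _ => by simp [jm]
  | k + 1, hk => by
    have ih := h.jm_sq_of_basic hb (k := k) (by omega)
    have h1 := h.jm_mul_add_of_basic hb hk
    have h2 := h.sq k hk
    have hc1 : (k : R) * s k = s k * k := (Nat.cast_commute _ _).eq
    have hc2 : (k : R) * jm s k = jm s k * k := (Nat.cast_commute _ _).eq
    rw [h.jm_succ_of_basic hb hk]
    push_cast at ih ⊢
    linear_combination (norm := noncomm_ring) ih + 2 * (k + 1) * (k + 1) * h2 + 2 * (k + 1) * h1
      - 2 * (k + 1) * hc1 * s k - 2 * hc2 * s k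
      
end Ring

section Module

variable {V : Type*} [AddCommGroup V] [Module ℂ V] {n : ℕ}
  {s : ℕ → End ℂ V}

/-- The product of the first two generators has no nonzero fixed vector. -/
def Basic (s : ℕ → End ℂ V) : Prop := ∀ v, s 0 (s 1 v) = v → v = 0

theorem Basic.mul_add (hb : Basic s) (h : IsSpin n s) (hn : 3 ≤ n) :
    s 0 * s 1 + s 1 * s 0 = -1 := by
  have h0 := h.sq 0 (by omega)
  have h1 := h.sq 1 (by omega)
  have hc := h.cube_mul_succ (i := 0) (by omega)
  rw [zero_add] at hc
  ext v
  have h2 : s 0 * s 1 * (s 0 * s 1 + s 1 * s 0 + 1) = s 0 * s 1 + s 1 * s 0 + 1 := by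
    have : s 0 * s 1 * s 0 * s 1 = s 1 * s 0 := by
      linear_combination (norm := noncomm_ring) hc * s 1 * s 0 -
        s 0 * s 1 * s 0 * s 1 * s 0 * h1 * s 0 - s 0 * s 1 * s 0 * s 1 * h0
    linear_combination (norm := noncomm_ring) this + s 0 * h1 * s 0 + h0
  have := hb ((s 0 * s 1 + s 1 * s 0 + 1) v) (congrArg (· v) h2)
  rw [LinearMap.add_apply] at this
  exact eq_neg_of_add_eq_zero_left this

theorem trace_mul_succ (h : IsSpin n s) {i : ℕ} (hi : i + 2 < n) :
    LinearMap.trace ℂ V (s i * s (i + 1)) = LinearMap.trace ℂ V (s 0 * s 1) := by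
  induction i with
  | zero => rfl
  | succ i ih =>
    rw [← ih (by omega)]
    have h1 := h.mul_mul_eq_one hi
    have h2 := h.mul_mul_conj hi
    have h3 := h.mul_mul_eq_one' hi
    set g := s i * s (i + 1) * s (i + 2) with hg
    set g' := s (i + 2) * s (i + 1) * s i with hg'
    have e1 : s (i + 1) * s (i + 2) = g * ((s i * s (i + 1)) * g') := by
      rw [← mul_assoc, h2, mul_assoc, h1, mul_one]
    show LinearMap.trace ℂ V (s (i + 1) * s (i + 2)) = _
    rw [e1, LinearMap.trace_mul_comm, mul_assoc, h3, mul_one]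

theorem trace_mul_jm (h : IsSpin n s) {k : ℕ} (hk : k + 1 < n) :
    LinearMap.trace ℂ V (s k * jm s k) = k * LinearMap.trace ℂ V (s 0 * s 1) := by
  induction k with
  | zero => simp [jm]
  | succ k ih =>
    have h1 := h.jm_anti_of_le (j := k + 1) (k := k) le_rfl hk
    have h2 := h.trace_mul_succ (i := k) hk
    have h3 := h.sq (k + 1) hk
    rw [jm_succ, mul_sub, map_sub, LinearMap.trace_mul_comm, h2]
    have e : LinearMap.trace ℂ V (s (k + 1) * (s k * jm s k * s k)) =
        - LinearMap.trace ℂ V (s k * jm s k) := by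
      calc _ = LinearMap.trace ℂ V ((s (k + 1) * s k * jm s k) * s k) := by
            simp only [mul_assoc]
        _ = LinearMap.trace ℂ V (s k * s (k + 1) * s k * jm s k) := by
            rw [LinearMap.trace_mul_comm]; simp only [mul_assoc]
        _ = LinearMap.trace ℂ V (-(s (k + 1) * (s k * jm s k * s (k + 1)))) := by
            rw [h.braid k hk]; congr 1
            linear_combination (norm := noncomm_ring) s (k + 1) * s k * h1
        _ = _ := by
            rw [map_neg, LinearMap.trace_mul_comm, mul_assoc, h3, mul_one]
    rw [e, ih (by omega)]
    push_cast
    ring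

variable [FiniteDimensional ℂ V]

theorem Basic.two_pow_le_finrank (hb : Basic s) (h : IsSpin n s) (hn : 3 ≤ n) [Nontrivial V] :
    2 ^ ((n - 1) / 2) ≤ finrank ℂ V := by
  have hb' := fun i hi => h.succ_mul_add (hb.mul_add h hn) (i := i) hi
  rw [← finrank_top ℂ V]
  refine two_pow_le_finrank_of_anticomm top_ne_bot _ (e := fun i => jm s (i + 1))
    (fun i hi => ⟨(i + 1) * (i + 2) / 2, ?_, ?_⟩) (fun j hj i hij => ?_) (fun _ _ _ _ => trivial)
  · have h1 : (i + 1 : ℂ) ≠ 0 := by exact_mod_cast i.succ_ne_zero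
    have h2 : (i + 2 : ℂ) ≠ 0 := by exact_mod_cast (i + 1).succ_ne_zero
    simp [h1, h2]
  · have := h.jm_sq_of_basic hb' (k := i + 1) (by omega)
    ext v
    have := congrArg (· v) this
    have h2 : (2 : ℂ) • (jm s (i + 1) * jm s (i + 1)) v = ((i + 1) * (i + 2) : ℂ) • v := by
      rw [ofNat_smul_eq_nsmul]
      simp only [End.mul_apply, End.natCast_apply, End.ofNat_apply] at this ⊢
      rw [this, ← Nat.cast_smul_eq_nsmul ℂ]
      push_cast
      ring_nf
    rw [LinearMap.smul_apply, End.one_apply, div_eq_inv_mul, mul_smul, ← h2, smul_smul]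
    norm_num
  · exact h.jm_anti_jm (by omega) (by omega)

theorem trace_jm_sq (h : IsSpin n s) {k : ℕ} (hk : k < n) :
    LinearMap.trace ℂ V (jm s k * jm s k) =
      k * finrank ℂ V - k * (k - 1) * LinearMap.trace ℂ V (s 0 * s 1) := by
  induction k with
  | zero => simp [jm]
  | succ k ih =>
    have h3 := h.sq k hk
    have e : jm s (k + 1) * jm s (k + 1) =
        1 - jm s k * s k - s k * jm s k + s k * (jm s k * jm s k * s k) := by
      rw [jm_succ]
      linear_combination (norm := noncomm_ring) h3 - h3 * jm s k * s k - s k * jm s k * h3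
        + s k * jm s k * h3 * jm s k * s k
    rw [e, map_add, map_sub, map_sub, LinearMap.trace_one,
      LinearMap.trace_mul_comm _ (jm s k) (s k), h.trace_mul_jm hk,
      LinearMap.trace_mul_comm _ (s k), mul_assoc, h3, mul_one, ih (by omega)]
    push_cast
    ring

theorem three_mul_finrank_ker (h : IsSpin n s) {i : ℕ} (hi : i + 2 < n) :
    3 * (finrank ℂ (LinearMap.ker (s i * s (i + 1) - 1)) : ℂ) =
      finrank ℂ V + 2 * LinearMap.trace ℂ V (s 0 * s 1) := by
  have h0 := h.sq i (by omega)
  have h1 := h.sq (i + 1) (by omega)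
  have hc := h.cube_mul_succ hi
  have : (s i * s (i + 1)) ^ 2 = s (i + 1) * s i := by
    linear_combination (norm := noncomm_ring) hc * s (i + 1) * s i -
      s i * s (i + 1) * s i * s (i + 1) * s i * h1 * s i - s i * s (i + 1) * s i * s (i + 1) * h0
  rw [three_mul_finrank_ker_sub_one hc, this, LinearMap.trace_mul_comm _ (s (i + 1)),
    h.trace_mul_succ hi]
  ring

end Module

section Transfer

variable {V W : Type*} [AddCommGroup V] [Module ℂ V] [AddCommGroup W] [Module ℂ W] {n : ℕ}
  {s : ℕ → End ℂ V} {t : ℕ → End ℂ W}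

theorem of_injective (h : IsSpin n s) {f : W →ₗ[ℂ] V} (hf : Function.Injective f)
    (hst : ∀ i, i + 1 < n → ∀ w, f (t i w) = s i (f w)) : IsSpin n t where
  sq i hi := by
    ext w
    apply hf
    simpa [hst i hi] using congrArg (· (f w)) (h.sq i hi)
  braid i hi := by
    ext w
    apply hf
    simpa [hst i (by omega), hst (i + 1) (by omega)] using congrArg (· (f w)) (h.braid i hi)
  anti i j hij hj := by
    ext w
    apply hf
    simpa [hst i (by omega), hst j hj] using congrArg (· (f w)) (h.anti i j hij hj)

theorem of_surjective (h : IsSpin n s) {f : V →ₗ[ℂ] W} (hf : Function.Surjective f)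
    (hst : ∀ i, i + 1 < n → ∀ v, f (s i v) = t i (f v)) : IsSpin n t where
  sq i hi := by
    ext w
    obtain ⟨v, rfl⟩ := hf w
    simpa [← hst i hi] using congrArg (fun g => f (g v)) (h.sq i hi)
  braid i hi := by
    ext w
    obtain ⟨v, rfl⟩ := hf w
    simpa [← hst i (by omega), ← hst (i + 1) (by omega)] using
      congrArg (fun g => f (g v)) (h.braid i hi)
  anti i j hij hj := by
    ext w
    obtain ⟨v, rfl⟩ := hf w
    simpa [← hst i (by omega), ← hst j hj] using congrArg (fun g => f (g v)) (h.anti i j hij hj)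

/-- The generators `s 0, …, s (n - 2)` preserve `U`. -/
def Stable (n : ℕ) (s : ℕ → End ℂ V) (U : Submodule ℂ V) : Prop :=
  ∀ i, i + 1 < n → ∀ v ∈ U, s i v ∈ U

/-- The generators acting on a stable subspace. -/
noncomputable def sub {U : Submodule ℂ V} (hU : Stable n s U) (i : ℕ) : End ℂ U :=
  if h : i + 1 < n then (s i).restrict (hU i h) else 0

/-- The generators acting on the quotient by a stable subspace. -/
noncomputable def quot {U : Submodule ℂ V} (hU : Stable n s U) (i : ℕ) : End ℂ (V ⧸ U) :=
  if h : i + 1 < n then U.mapQ U (s i) (hU i h) else 0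

theorem sub_apply {U : Submodule ℂ V} (hU : Stable n s U) {i : ℕ} (hi : i + 1 < n) (u : U) :
    (sub hU i u : V) = s i u := by simp [sub, hi]

theorem quot_apply {U : Submodule ℂ V} (hU : Stable n s U) {i : ℕ} (hi : i + 1 < n) (v : V) :
    U.mkQ (s i v) = quot hU i (U.mkQ v) := by simp [quot, hi]

theorem isSpin_sub (h : IsSpin n s) {U : Submodule ℂ V} (hU : Stable n s U) :
    IsSpin n (sub hU) :=
  h.of_injective U.subtype_injective fun _ hi u => sub_apply hU hi u

theorem isSpin_quot (h : IsSpin n s) {U : Submodule ℂ V} (hU : Stable n s U) :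
    IsSpin n (quot hU) :=
  h.of_surjective U.mkQ_surjective fun _ hi v => quot_apply hU hi v

theorem basic_of_sub_quot {U : Submodule ℂ V} (hU : Stable n s U) (hn : 3 ≤ n)
    (h1 : Basic (sub hU)) (h2 : Basic (quot hU)) : Basic s := by
  intro v hv
  have hq := h2 (U.mkQ v) (by
    rw [← quot_apply hU (by omega), ← quot_apply hU (by omega), hv])
  have hvU : v ∈ U := by simpa using hq
  have := h1 ⟨v, hvU⟩ (by
    apply Subtype.ext
    rw [sub_apply hU (by omega), sub_apply hU (by omega), hv])
  exact congrArg Subtype.val this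

/-- There are no nontrivial stable subspaces. -/
def Irred (n : ℕ) (s : ℕ → End ℂ V) : Prop :=
  ∀ U : Submodule ℂ V, Stable n s U → U = ⊥ ∨ U = ⊤

theorem Irred.exists_eq_smul [FiniteDimensional ℂ V] [Nontrivial V] (hs : Irred n s) {A : End ℂ V}
    (hA : ∀ i, i + 1 < n → Commute (s i) A) : ∃ μ : ℂ, A = μ • 1 := by
  obtain ⟨μ, v, -, hv0, hv⟩ := exists_eigenvector_mem (top_ne_bot (α := Submodule ℂ V))
    (A := A) fun _ _ => trivial
  refine ⟨μ, ?_⟩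
  have hker := hs (LinearMap.ker (A - μ • 1)) fun i hi w hw => by
    have h1 : A w = μ • w := by simpa [sub_eq_zero] using hw
    have h2 : A (s i w) = s i (A w) := congrArg (· w) (hA i hi).eq.symm
    simp [h2, h1]
  rcases hker with hker | hker
  · have : v ∈ LinearMap.ker (A - μ • 1) := by simp [hv]
    rw [hker] at this
    exact absurd (by simpa using this) hv0
  · exact sub_eq_zero.1 (LinearMap.ker_eq_top.1 hker)

end Transfer

/-- Every spin module of dimension at most `d` is basic. -/
def BasicAt (n d : ℕ) : Prop :=
  ∀ (V : Type) [AddCommGroup V] [Module ℂ V] [FiniteDimensional ℂ V] (s : ℕ → End ℂ V),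
    IsSpin n s → finrank ℂ V ≤ d → Basic s

theorem BasicAt.of_le {m n d : ℕ} (h : BasicAt m d) (hmn : m ≤ n) : BasicAt n d :=
  fun V _ _ _ s hs hd => h V s (hs.mono hmn) hd

theorem basicAt_of_irred {n d : ℕ} (hn : 3 ≤ n)
    (H : ∀ (V : Type) [AddCommGroup V] [Module ℂ V] [FiniteDimensional ℂ V] [Nontrivial V]
      (s : ℕ → End ℂ V), IsSpin n s → finrank ℂ V ≤ d → Irred n s → Basic s) :
    BasicAt n d := by
  intro V _ _ _ s hs hd
  induction hm : finrank ℂ V using Nat.strong_induction_on generalizing V with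
  | _ m ih =>
    by_cases hi : Irred n s
    · rcases subsingleton_or_nontrivial V with hV | hV
      · exact fun v _ => Subsingleton.elim v 0
      · exact H V s hs hd hi
    · simp only [Irred, not_forall, not_or] at hi
      obtain ⟨U, hU, hbot, htop⟩ := hi
      have h1 := Submodule.finrank_lt htop
      have h2 := U.finrank_quotient_add_finrank
      have h3 : finrank ℂ U ≠ 0 := fun h => hbot (Submodule.finrank_eq_zero.1 h)
      exact basic_of_sub_quot hU hn (ih _ (by omega) U _ (hs.isSpin_sub hU) (by omega) rfl)
        (ih _ (by omega) (V ⧸ U) _ (hs.isSpin_quot hU) (by omega) rfl)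

theorem BasicAt.le_finrank {n : ℕ} (hn : 3 ≤ n) (H : BasicAt n (2 ^ ((n - 1) / 2)))
    {V : Type} [AddCommGroup V] [Module ℂ V] [FiniteDimensional ℂ V] {s : ℕ → End ℂ V}
    (hs : IsSpin n s) {U : Submodule ℂ V} (hU : Stable n s U) (hne : U ≠ ⊥) :
    2 ^ ((n - 1) / 2) ≤ finrank ℂ U := by
  have := Submodule.nontrivial_iff_ne_bot.2 hne
  by_contra! hlt
  exact hlt.not_ge ((H U _ (hs.isSpin_sub hU) hlt.le).two_pow_le_finrank (hs.isSpin_sub hU) hn)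

section Ring

variable {R : Type*} [Ring R] {n : ℕ} {s : ℕ → R}

theorem four_relations (h : IsSpin n s) (hn : 4 ≤ n) :
    (s 0 * s 1 * s 2 - s 2 * s 1 * s 0) * (s 0 * s 1 * s 2 - s 2 * s 1 * s 0) = -1 - 1 ∧
    s 0 * s 2 * (s 0 * s 2) = -1 ∧ s 1 * s 0 * s 2 * s 1 * (s 1 * s 0 * s 2 * s 1) = -1 ∧
    s 0 * s 2 * (s 1 * s 0 * s 2 * s 1) = -(s 1 * s 0 * s 2 * s 1 * (s 0 * s 2)) ∧
    Commute (s 0 * s 2) (s 0 * s 1 * s 2 - s 2 * s 1 * s 0) ∧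
    Commute (s 1 * s 0 * s 2 * s 1) (s 0 * s 1 * s 2 - s 2 * s 1 * s 0) := by
  have ha := h.sq 0 (by omega)
  have hb := h.sq 1 (by omega)
  have hc := h.sq 2 (by omega)
  have hca : s 2 * s 0 = -(s 0 * s 2) := h.anti' (by omega) (by omega) (by omega)
  have hbab : s 1 * (s 0 * s 1) = s 0 * (s 1 * s 0) := by
    simpa only [mul_assoc] using (h.braid 0 (by omega)).symm
  have hcbc : s 2 * (s 1 * s 2) = s 1 * (s 2 * s 1) := by
    simpa only [mul_assoc] using (h.braid 1 (by omega)).symm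
  generalize s 0 = a at *
  generalize s 1 = b at *
  generalize s 2 = c at *
  have ha' x : a * (a * x) = x := by rw [← mul_assoc, ha, one_mul]
  have hb' x : b * (b * x) = x := by rw [← mul_assoc, hb, one_mul]
  have hc' x : c * (c * x) = x := by rw [← mul_assoc, hc, one_mul]
  have hca' x : c * (a * x) = -(a * (c * x)) := by rw [← mul_assoc, hca]; noncomm_ring
  have hbab' x : b * (a * (b * x)) = a * (b * (a * x)) := by
    linear_combination (norm := noncomm_ring) hbab * x
  have hcbc' x : c * (b * (c * x)) = b * (c * (b * x)) := by
    linear_combination (norm := noncomm_ring) hcbc * x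
  have hcbac : c * (b * (a * c)) = -(b * (c * (b * a))) := by
    linear_combination (norm := noncomm_ring) c * b * hca - hcbc * a
  have hcbac' x : c * (b * (a * (c * x))) = -(b * (c * (b * (a * x)))) := by
    linear_combination (norm := noncomm_ring) hcbac * x
  refine ⟨?_, ?_, ?_, ?_, ?_, ?_⟩ <;> (try show _ = _) <;>
  simp only [mul_assoc, ha, hb, hc, hca, hbab, hcbc, ha', hb', hc', hca', hbab', hcbc', hcbac,
    hcbac', sub_mul, mul_sub, mul_neg, neg_neg, mul_one] <;>
  noncomm_ring

end Ring

theorem four_dvd_finrank {V : Type*} [AddCommGroup V] [Module ℂ V] [FiniteDimensional ℂ V] {n : ℕ}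
    {s : ℕ → End ℂ V} (h : IsSpin n s) (hn : 6 ≤ n) : 4 ∣ finrank ℂ V := by
  obtain ⟨h1, h2, h3, h4, h5, h6⟩ := h.four_relations (by omega)
  set ζ := s 0 * s 1 * s 2 - s 2 * s 1 * s 0 with hζ
  obtain ⟨a, ha⟩ := IsAlgClosed.exists_eq_mul_self (-2 : ℂ)
  have ha0 : a ≠ 0 := by rintro rfl; norm_num at ha
  have hanti : ζ * s 4 = -(s 4 * ζ) := by
    have e0 := h.anti 0 4 (by omega) (by omega)
    have e1 := h.anti 1 4 (by omega) (by omega)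
    have e2 := h.anti 2 4 (by omega) (by omega)
    rw [hζ]
    linear_combination (norm := noncomm_ring) s 0 * s 1 * e2 - s 0 * e1 * s 2 + e0 * s 1 * s 2
      - s 2 * s 1 * e0 + s 2 * e1 * s 0 - e2 * s 1 * s 0
  have f1 := finrank_eq_two_mul_finrank_inf_ker (U := ⊤) (A := ζ) (B := s 4) (b := 1)
    (fun _ _ => trivial) (fun _ _ => trivial) ha0 one_ne_zero
    (by rw [h1, ← ha]; module) (by rw [h.sq 4 (by omega), one_smul])
    hanti
  have hstab {A : End ℂ V} (hA : Commute A ζ) v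
      (hv : v ∈ (⊤ ⊓ LinearMap.ker (ζ - a • 1) : Submodule ℂ V)) :
      A v ∈ (⊤ ⊓ LinearMap.ker (ζ - a • 1) : Submodule ℂ V) := by
    refine ⟨trivial, ?_⟩
    have e1 : ζ v = a • v := by
      simpa [sub_eq_zero] using hv.2
    have e2 : ζ (A v) = A (ζ v) := congrArg (· v) hA.eq.symm
    rw [SetLike.mem_coe, LinearMap.mem_ker, LinearMap.sub_apply, sub_eq_zero, e2, e1]
    simp
  have f2 := finrank_eq_two_mul_finrank_inf_ker (A := s 0 * s 2) (B := s 1 * s 0 * s 2 * s 1)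
    (a := Complex.I) (b := -1) (hstab h5) (hstab h6) Complex.I_ne_zero (by norm_num)
    (by rw [h2, Complex.I_mul_I, neg_smul, one_smul]) (by rw [h3, neg_smul, one_smul]) h4
  rw [finrank_top] at f1
  omega

theorem isIntegral_eigenvalue {V : Type*} [AddCommGroup V] [Module ℂ V] {n : ℕ}
    {s : ℕ → End ℂ V} (h : IsSpin n s) {k : ℕ} (hk : k < n) {b : ℕ → ℂ} {v : V} (hv : v ≠ 0)
    (hb : ∀ j ≤ k, (jm s j * jm s j) v = b j • v) : IsIntegral ℤ (b k) := by
  induction k generalizing b v with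
  | zero =>
    have := hb 0 le_rfl
    have hb0 : b 0 = 0 := by
      exact (smul_eq_zero.1 (this.symm.trans (by simp [jm]))).resolve_right hv
    rw [hb0]
    exact isIntegral_zero
  | succ k ih =>
    have ha := ih (by omega) hv fun j hj => hb j (by omega)
    have hak := hb k (by omega)
    have hbk := hb (k + 1) le_rfl
    set a := b k
    set b' := b (k + 1)
    set D := jm s k - jm s (k + 1) with hD
    have hsD : D * s k = s k * D := by
      have h1 := h.mul_jm_add hk
      have h2 := h.jm_succ_mul hk
      rw [hD]
      linear_combination (norm := noncomm_ring) h2 - h1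
    have hDD : D * D = jm s k * jm s k + jm s (k + 1) * jm s (k + 1) := by
      have := h.jm_anti_jm (j := k) (k := k + 1) (by omega) hk
      rw [hD]
      linear_combination (norm := noncomm_ring) -this
    have hDD' : D (D v) = (a + b') • v := by
      rw [add_smul, ← hak, ← hbk]
      exact congrArg (· v) hDD
    have hsk v : (jm s k * jm s k) (s k v) = s k ((jm s (k + 1) * jm s (k + 1)) v) + D v :=
      congrArg (· v) (h.sq_jm_mul hk)
    have hcD j (hj : j ≤ k) : (jm s j * jm s j) (D v) = b j • D v := by
      have h1 : Commute (jm s j * jm s j) D :=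
        (h.sq_jm_comm (by omega) (by omega)).sub_right (h.sq_jm_comm (by omega) hk)
      have h2 : (jm s j * jm s j) (D v) = D ((jm s j * jm s j) v) := congrArg (· v) h1.eq
      rw [h2, hb j (by omega), map_smul]
    by_cases hv' : (a - b') • s k v - D v = 0
    · have e1 : D v = (a - b') • s k v := (sub_eq_zero.1 hv').symm
      have e2 : D (D v) = ((a - b') * (a - b')) • v := by
        have h1 : D (s k v) = s k (D v) := congrArg (· v) hsD
        have h2 : s k (s k v) = v := congrArg (· v) (h.sq k hk)
        rw [e1, map_smul, h1, e1, map_smul, h2, smul_smul]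
      have e3 : (a - b') * (a - b') = a + b' := smul_left_injective ℂ hv (e2.symm.trans hDD')
      have ht : IsIntegral ℤ (b' - a) := by
        refine IsIntegral.of_aeval_monic (p := Polynomial.X ^ 2 - Polynomial.X)
          (Polynomial.monic_X_pow_sub (by simp)) (by
            rw [Polynomial.natDegree_sub_eq_left_of_natDegree_lt] <;> simp) ?_
        have : Polynomial.aeval (b' - a) (Polynomial.X ^ 2 - Polynomial.X : Polynomial ℤ) =
            a + a := by
          simp only [map_sub, map_pow, Polynomial.aeval_X]
          linear_combination e3
        rw [this]
        exact ha.add ha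
      simpa using ht.add ha
    · have := ih (b := Function.update b k b') (by omega) hv' fun j hj => ?_
      · simpa using this
      rw [map_sub, map_smul, hcD j hj]
      rcases hj.lt_or_eq with hlt | rfl
      · have h1 := h.sq_jm_comm_of_ne (j := k) (k := j) hk (by omega) (by omega) (by omega)
        have h2 : (jm s j * jm s j) (s k v) = s k ((jm s j * jm s j) v) :=
          congrArg (· v) h1.eq.symm
        rw [h2, hb j (by omega), map_smul, Function.update_of_ne (by omega)]
        module
      · rw [hsk, hbk, map_smul, Function.update_self]
        module

theorem ker_mul_succ_ne_top {V : Type*} [AddCommGroup V] [Module ℂ V] [Nontrivial V] {n : ℕ}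
    {s : ℕ → End ℂ V} (h : IsSpin n s) (hn : 4 ≤ n) : LinearMap.ker (s 0 * s 1 - 1) ≠ ⊤ := by
  intro hker
  have h01 : s 0 * s 1 = 1 := sub_eq_zero.1 (LinearMap.ker_eq_top.1 hker)
  have h0 := h.sq 0 (by omega)
  have h2 := h.sq 2 (by omega)
  have hb := h.braid 1 (by omega)
  have ha := h.anti 0 2 (by omega) (by omega)
  have e01 : s 1 = s 0 := by
    linear_combination (norm := noncomm_ring) s 0 * h01 - h0 * s 1
  rw [show 1 + 1 = 2 from rfl, e01] at hb
  have e1 : (1 : End ℂ V) + 1 = 0 := by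
    have e2 : s 0 = s 2 := by
      linear_combination (norm := noncomm_ring) hb - ha * s 0 + s 2 * h0 + s 2 * ha - h2 * s 0
    rw [← e2] at ha
    linear_combination (norm := noncomm_ring) ha - h0 - h0
  obtain ⟨v, hv⟩ := exists_ne (0 : V)
  have := congrArg (· v) e1
  have : (2 : ℂ) • v = 0 := by rw [two_smul]; exact this
  simp [hv] at this

theorem basic_iff {V : Type*} [AddCommGroup V] [Module ℂ V] {s : ℕ → End ℂ V} :
    Basic s ↔ LinearMap.ker (s 0 * s 1 - 1) = ⊥ := by
  rw [Submodule.eq_bot_iff]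
  simp [Basic, sub_eq_zero]

theorem basicAt_seven : BasicAt 7 8 := by
  refine basicAt_of_irred (by omega) fun V _ _ _ _ s h hd hirr => ?_
  rw [basic_iff]
  by_contra hW
  obtain ⟨l, hl⟩ := hirr.exists_eq_smul fun i hi => h.sum_sq_jm_comm hi
  obtain ⟨b, v, -, hv0, hv⟩ := exists_common_eigenvector_mem
    (A := fun i => jm s (min i 6) * jm s (min i 6))
    (fun i j => (h.sq_jm_comm (by omega) (by omega)).mul_right (h.sq_jm_comm (by omega) (by omega)))
    7 (top_ne_bot (α := Submodule ℂ V)) fun _ _ _ => trivial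
  have hv' i (hi : i < 7) : (jm s i * jm s i) v = b i • v := by
    have := hv i hi
    rwa [min_eq_left (by omega)] at this
  have hlint : IsIntegral ℤ l := by
    have : l = ∑ i ∈ Finset.range 7, b i := by
      have h1 := congrArg (· v) hl
      simp only [LinearMap.sum_apply] at h1
      rw [Finset.sum_congr rfl fun i hi => hv' i (Finset.mem_range.1 hi), ← Finset.sum_smul] at h1
      exact smul_left_injective ℂ hv0 h1.symm
    rw [this]
    exact IsIntegral.sum _ fun i hi => h.isIntegral_eigenvalue (Finset.mem_range.1 hi) hv0
      fun j hj => hv' j (by rw [Finset.mem_range] at hi; omega)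
  have htr := congrArg (LinearMap.trace ℂ V) hl
  rw [map_sum, map_smul, LinearMap.trace_one, Finset.sum_congr rfl fun i hi =>
    h.trace_jm_sq (Finset.mem_range.1 hi)] at htr
  have hker := h.three_mul_finrank_ker (i := 0) (by omega)
  have hfour := h.four_dvd_finrank (by omega)
  have hpos : 0 < finrank ℂ V := finrank_pos
  have hlt := Submodule.finrank_lt (h.ker_mul_succ_ne_top (by omega))
  have hWpos : finrank ℂ (LinearMap.ker (s 0 * s 1 - 1)) ≠ 0 :=
    fun h0 => hW (Submodule.finrank_eq_zero.1 h0)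
  rw [zero_add] at hker
  set W := finrank ℂ (LinearMap.ker (s 0 * s 1 - 1))
  set d := finrank ℂ V
  simp only [Finset.sum_range_succ, Finset.sum_range_zero] at htr
  have hd0 : (d : ℂ) ≠ 0 := by exact_mod_cast hpos.ne'
  have hl2 : l = algebraMap ℚ ℂ (56 - 105 * W / d) := by
    have : l * d = 56 * d - 105 * W := by
      rw [smul_eq_mul] at htr
      push_cast at htr
      linear_combination -htr + 35 * hker
    push_cast [map_sub, map_div₀, map_mul]
    simp only [map_ofNat]
    field_simp
    linear_combination this
  rw [hl2, isIntegral_algebraMap_iff (algebraMap ℚ ℂ).injective] at hlint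
  obtain ⟨m, hm⟩ := IsIntegrallyClosed.isIntegral_iff.1 hlint
  have hd0' : (d : ℚ) ≠ 0 := by exact_mod_cast hpos.ne'
  have hm2 : (m : ℤ) * d = 56 * d - 105 * W := by
    have : (m : ℚ) * d = 56 * d - 105 * W := by
      rw [eq_intCast] at hm
      rw [hm]
      field_simp
    exact_mod_cast this
  obtain ⟨q, hq⟩ := hfour
  have : q = 1 ∨ q = 2 := by omega
  rcases this with rfl | rfl
  · rw [hq] at hm2 hlt
    omega
  · rw [hq] at hm2 hlt
    omega

section

variable {V : Type} [AddCommGroup V] [Module ℂ V] [FiniteDimensional ℂ V]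
  {s : ℕ → End ℂ V} {m : ℕ}

theorem irred_of_not_basic (h : IsSpin m s) (hm : 3 ≤ m) (H : BasicAt m (2 ^ ((m - 1) / 2)))
    (hd : finrank ℂ V ≤ 2 * 2 ^ ((m - 1) / 2)) (hs : ¬ Basic s) : Irred m s := by
  intro U hU
  by_contra! hne
  have h1 := H.le_finrank hm h hU hne.1
  have h2 := U.finrank_quotient_add_finrank
  have h3 := Submodule.finrank_lt hne.2
  have : Nontrivial (V ⧸ U) := Submodule.Quotient.nontrivial_iff.2 hne.2
  have h4 := H.le_finrank hm (h.isSpin_quot hU) (U := ⊤) (fun _ _ _ _ => trivial) top_ne_bot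
  rw [finrank_top] at h4
  exact hs (basic_of_sub_quot hU hm (H U _ (h.isSpin_sub hU) (by omega))
    (H _ _ (h.isSpin_quot hU) (by omega)))

variable [Nontrivial V]

/-- The Jucys–Murphy elements centralizing a subalgebra which still acts irreducibly. -/
theorem jm_eq_of_irred (h : IsSpin (m + 2) s) (hm : 2 ≤ m) (hirr : Irred m s) :
    jm s m = s m ∧ m * LinearMap.trace ℂ V (s 0 * s 1) = finrank ℂ V := by
  have hsq := h.sq m (by omega)
  have hscalar {A : End ℂ V} (hA : ∀ i, i + 1 < m → s i * A = -(A * s i)) :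
      ∃ μ : ℂ, A = μ • s m := by
    obtain ⟨μ, hμ⟩ := hirr.exists_eq_smul (A := A * s m) fun i hi => by
      have h1 := hA i hi
      have h2 := h.anti i m (by omega) (by omega)
      show _ = _
      linear_combination (norm := noncomm_ring) h1 * s m - A * h2
    refine ⟨μ, ?_⟩
    calc A = A * s m * s m := by rw [mul_assoc, hsq, mul_one]
      _ = _ := by rw [hμ]; simp
  obtain ⟨μ, hμ⟩ := hscalar fun i hi => h.jm_anti_of_lt (j := i) (k := m) hi (by omega)
  obtain ⟨ν, hν⟩ := hscalar fun i hi => h.jm_anti_of_lt (j := i) (k := m + 1) (by omega) (by omega)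
  have hsmul {a b : ℂ} (hab : a • (1 : End ℂ V) = b • 1) : a = b := by
    obtain ⟨v, hv⟩ := exists_ne (0 : V)
    exact smul_left_injective ℂ hv (congrArg (· v) hab)
  have hadd : μ + ν = 1 := hsmul (by
    have := h.mul_jm_add (k := m) (by omega)
    rw [hμ, hν, mul_smul_comm, smul_mul_assoc, hsq] at this
    rw [add_smul, one_smul, this])
  have hmul : μ * ν = -(μ * ν) := hsmul (by
    have := h.jm_anti_jm (j := m) (k := m + 1) (by omega) (by omega)
    rw [hμ, hν] at this
    simpa [hsq, smul_smul, mul_comm] using this)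
  have hmul : μ * ν = 0 := by linear_combination hmul / 2
  have h1 := h.trace_jm_sq (k := m) (by omega)
  have h2 := h.trace_jm_sq (k := m + 1) (by omega)
  rw [hμ, smul_mul_smul_comm, hsq, map_smul, LinearMap.trace_one, smul_eq_mul] at h1
  rw [hν, smul_mul_smul_comm, hsq, map_smul, LinearMap.trace_one, smul_eq_mul] at h2
  have hd : (finrank ℂ V : ℂ) ≠ 0 := by exact_mod_cast (finrank_pos (R := ℂ) (M := V)).ne'
  have hm0 : (m : ℂ) ≠ 0 := by exact_mod_cast (by omega : m ≠ 0)
  have hm1 : (m + 1 : ℂ) ≠ 0 := by exact_mod_cast m.succ_ne_zero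
  push_cast at h2
  rcases mul_eq_zero.1 hmul with h0 | h0
  · exfalso
    obtain rfl : ν = 1 := by linear_combination hadd - h0
    subst h0
    have e1 : (finrank ℂ V : ℂ) = (m - 1) * LinearMap.trace ℂ V (s 0 * s 1) :=
      mul_left_cancel₀ hm0 (by linear_combination -h1)
    have e2 : (finrank ℂ V : ℂ) = (m + 1) * LinearMap.trace ℂ V (s 0 * s 1) :=
      mul_left_cancel₀ hm0 (by linear_combination -h2)
    have e3 : LinearMap.trace ℂ V (s 0 * s 1) = 0 := by linear_combination (e1 - e2) / 2
    rw [e3, mul_zero] at e1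
    exact hd e1
  · obtain rfl : μ = 1 := by linear_combination hadd - h0
    subst h0
    refine ⟨by rw [hμ, one_smul], mul_left_cancel₀ hm1 (by linear_combination h2)⟩

end

theorem ker_sq_jm {V : Type*} [AddCommGroup V] [Module ℂ V] {s : ℕ → End ℂ V} {k : ℕ}
    (h : IsSpin (k + 3) s) (hjm : jm s (k + 1) = s (k + 1)) {w : V}
    (hw : jm s k (jm s k w) = 0) : jm s k w = 0 := by
  have hB := h.sq k (by omega)
  have hC := h.sq (k + 1) (by omega)
  have hbr := h.braid k (by omega)
  have hX : jm s k = s k - s k * s (k + 1) * s k := by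
    have := h.mul_jm_add (k := k) (by omega)
    rw [hjm] at this
    linear_combination (norm := noncomm_ring) s k * this - hB * jm s k
  set B := s k
  set C := s (k + 1)
  set X := jm s k
  have e2 : X * X = 1 + 1 - B * C - C * B := by
    rw [hX]
    linear_combination (norm := noncomm_ring) hB - B * C * hB - hB * C * B + B * C * hB * C * B
      + B * hC * B + hB
  have e3 : X * X * X = X + X + X := by
    rw [e2, hX]
    linear_combination (norm := noncomm_ring) hbr * C * B + C * B * hC * B
      + C * hB * C * B + hC * B
  have e4 : X (X (X w)) = (3 : ℂ) • X w := by
    rw [show (3 : ℂ) • X w = X w + X w + X w by module]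
    exact congrArg (· w) e3
  rw [hw, map_zero] at e4
  exact (smul_eq_zero.1 e4.symm).resolve_left (by norm_num)

theorem false_of_jm_eq {V : Type} [AddCommGroup V] [Module ℂ V] [FiniteDimensional ℂ V]
    [Nontrivial V] {s : ℕ → End ℂ V} {p : ℕ} (h : IsSpin (p + 4) s) (hp : 7 ≤ p)
    (H : BasicAt p (2 ^ ((p - 1) / 2))) (hd : finrank ℂ V ≤ 4 * 2 ^ ((p - 1) / 2))
    (hjm : jm s (p + 2) = s (p + 2))
    (htr : (p + 2 : ℕ) * LinearMap.trace ℂ V (s 0 * s 1) = finrank ℂ V) : False := by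
  have hker := h.three_mul_finrank_ker (i := p + 1) (by omega)
  set K := LinearMap.ker (s (p + 1) * s (p + 1 + 1) - 1) with hK
  have hdim : 3 * (p + 2) * finrank ℂ K = (p + 4) * finrank ℂ V := by
    have : (3 * (p + 2) * finrank ℂ K : ℂ) = (p + 4) * finrank ℂ V := by
      push_cast at htr
      linear_combination (p + 2) * hker + 2 * htr
    exact_mod_cast this
  have hVpos : 0 < finrank ℂ V := finrank_pos
  have hKne : K ≠ ⊥ := by
    intro h0
    rw [h0, finrank_bot, mul_zero] at hdim
    exact (Nat.mul_pos (by omega) hVpos).ne hdim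
  have hKlt : finrank ℂ K < 2 * 2 ^ ((p - 1) / 2) := by
    by_contra! hge
    nlinarith
  have hB := h.sq (p + 1) (by omega)
  have hC := h.sq (p + 2) (by omega)
  have hBX := h.jm_anti_of_le (j := p + 1) (k := p) (by omega) (by omega)
  have hCX := h.jm_anti_of_le (j := p + 2) (k := p) (by omega) (by omega)
  set B := s (p + 1) with hBdef
  set C := s (p + 2) with hCdef
  set X := jm s p with hX
  have memK v : v ∈ K ↔ B (C v) = v := by
    rw [hK, LinearMap.mem_ker, LinearMap.sub_apply, sub_eq_zero]; rfl
  have stabK {A : End ℂ V} (hA : Commute A (B * C)) v (hv : v ∈ K) : A v ∈ K := by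
    rw [memK] at hv ⊢
    have : B (C (A v)) = A (B (C v)) := congrArg (· v) hA.eq.symm
    rw [this, hv]
  have hsA i (hi : i + 1 < p) : Commute (s i) (C * X) := by
    have h1 : s i * C = -(C * s i) := h.anti i (p + 2) (by omega) (by omega)
    have h2 : s i * X = -(X * s i) := h.jm_anti_of_lt hi (by omega)
    show _ = _
    linear_combination (norm := noncomm_ring) h1 * X - C * h2
  have hsBC i (hi : i + 1 < p) : Commute (s i) (B * C) := by
    have h1 : s i * C = -(C * s i) := h.anti i (p + 2) (by omega) (by omega)
    have h2 : s i * B = -(B * s i) := h.anti i (p + 1) (by omega) (by omega)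
    show _ = _
    linear_combination (norm := noncomm_ring) h2 * C - B * h1
  have hCB v (hv : v ∈ K) : C v = B v := by
    rw [memK] at hv
    have : B (B (C v)) = C v := congrArg (· (C v)) hB
    rw [← this, hv]
  have hCK v (hv : v ∈ K) : C v ∈ K := by
    have e1 : C (C v) = v := congrArg (· v) hC
    rw [memK, e1, hCB v hv]
  have hXK v (hv : v ∈ K) : X v ∈ K := stabK (by
    show _ = _
    linear_combination (norm := noncomm_ring) hBX * C - B * hCX) v hv
  obtain ⟨μ, v, hv, hv0, hvμ⟩ := exists_eigenvector_mem hKne (A := C * X)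
    fun v hv => hCK _ (hXK v hv)
  have hstab (ν : ℂ) : Stable p s (K ⊓ LinearMap.ker (C * X - ν • 1)) := by
    intro i hi u hu
    refine ⟨stabK (hsBC i hi) u hu.1, ?_⟩
    have h1 : (C * X) u = ν • u := by simpa [sub_eq_zero] using hu.2
    have h2 : (C * X) (s i u) = s i ((C * X) u) := congrArg (· u) (hsA i hi).eq.symm
    rw [SetLike.mem_coe, LinearMap.mem_ker, LinearMap.sub_apply, h2, h1]
    simp
  have hmem (ν : ℂ) u : u ∈ K ⊓ LinearMap.ker (C * X - ν • 1) ↔ u ∈ K ∧ C (X u) = ν • u := by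
    simp [sub_eq_zero]
  have hμ : μ = 0 := by
    by_contra hμ
    have hp' : IsSpin p s := h.mono (by omega)
    have hge (ν : ℂ) (hne : K ⊓ LinearMap.ker (C * X - ν • 1) ≠ ⊥) :=
      H.le_finrank (by omega) hp' (hstab ν) hne
    have h1 := hge μ ((Submodule.ne_bot_iff _).2 ⟨v, (hmem _ _).2 ⟨hv, hvμ⟩, hv0⟩)
    have h2 := hge (-μ) ((Submodule.ne_bot_iff _).2 ⟨C v, (hmem _ _).2 ⟨hCK v hv, ?_⟩, ?_⟩)
    · have h3 := Submodule.finrank_sup_add_finrank_inf_eq (K ⊓ LinearMap.ker (C * X - μ • 1))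
        (K ⊓ LinearMap.ker (C * X - (-μ) • 1))
      have h4 : (K ⊓ LinearMap.ker (C * X - μ • 1)) ⊓ (K ⊓ LinearMap.ker (C * X - (-μ) • 1)) = ⊥ := by
        refine (Submodule.eq_bot_iff _).2 fun u hu => ?_
        have e1 := ((hmem _ _).1 hu.1).2
        have e2 := ((hmem _ _).1 hu.2).2
        have : (2 * μ) • u = 0 := by
          rw [two_mul, add_smul]
          exact add_eq_zero_iff_eq_neg.2 (e1.symm.trans (e2.trans (neg_smul _ _)))
        exact (smul_eq_zero.1 this).resolve_left (by simpa using hμ)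
      have h5 := Submodule.finrank_mono (sup_le inf_le_left inf_le_left :
        (K ⊓ LinearMap.ker (C * X - μ • 1)) ⊔ (K ⊓ LinearMap.ker (C * X - (-μ) • 1)) ≤ K)
      rw [h4, finrank_bot] at h3
      omega
    · have e1 : X (C v) = - C (X v) := by
        have : C (X v) = - X (C v) := congrArg (· v) hCX
        rw [this, neg_neg]
      have e2 : C (X v) = μ • v := hvμ
      rw [e1, e2, map_neg, map_smul, neg_smul]
    · intro h0
      have e1 : C (C v) = v := congrArg (· v) hC
      rw [h0, map_zero] at e1
      exact hv0 e1.symm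
  have hXv : X v = 0 := by
    have e1 : C (C (X v)) = X v := congrArg (· (X v)) hC
    have e2 : C (X v) = μ • v := hvμ
    rw [← e1, e2, hμ, zero_smul, map_zero]
  have hYv : jm s (p + 1) v = 0 := by
    have h1 := h.mul_jm_add (k := p + 1) (by omega)
    rw [show p + 1 + 1 = p + 2 from rfl, hjm] at h1
    have h2 : B (jm s (p + 1) v) + C (B v) = v := congrArg (· v) h1
    have e1 : C (C v) = v := congrArg (· v) hC
    rw [← hCB v hv, e1, add_eq_right] at h2
    have e2 : B (B (jm s (p + 1) v)) = jm s (p + 1) v := congrArg (· (jm s (p + 1) v)) hB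
    rw [← e2, h2, map_zero]
  have hw : jm s (p + 1) (s p v) = v := by
    have h1 := h.mul_jm_add (k := p) (by omega)
    have h2 : s p (X v) + jm s (p + 1) (s p v) = v := congrArg (· v) h1
    rwa [hXv, map_zero, zero_add] at h2
  have := h.ker_sq_jm hjm (w := s p v) (by rw [hw, hYv])
  exact hv0 (hw.symm.trans this)

theorem basicAt (n : ℕ) (hn : 7 ≤ n) : BasicAt n (2 ^ ((n - 1) / 2)) := by
  induction n using Nat.strong_induction_on with
  | _ n ih =>
    rcases hn.eq_or_lt with rfl | hlt
    · exact basicAt_seven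
    rcases n.even_or_odd' with ⟨q, rfl | rfl⟩
    · have := (ih (2 * q - 1) (by omega) (by omega)).of_le (n := 2 * q) (by omega)
      rwa [show (2 * q - 1 - 1) / 2 = (2 * q - 1) / 2 by omega] at this
    obtain ⟨m, hm⟩ : ∃ m, 2 * q + 1 = m + 2 := ⟨2 * q - 1, by omega⟩
    rw [hm] at ih ⊢
    refine basicAt_of_irred (by omega) fun V _ _ _ _ s h hd _ => ?_
    by_contra hs
    have hd' : finrank ℂ V ≤ 2 * 2 ^ ((m - 1) / 2) := by
      rw [show (m + 2 - 1) / 2 = (m - 1) / 2 + 1 by omega, pow_succ] at hd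
      omega
    have hirr := irred_of_not_basic (h.mono (by omega)) (by omega) (ih m (by omega) (by omega))
      hd' hs
    obtain ⟨hjm, htr⟩ := h.jm_eq_of_irred (by omega) hirr
    rcases (by omega : m = 7 ∨ 9 ≤ m) with rfl | hm9
    · have hker := h.three_mul_finrank_ker (i := 0) (by omega)
      have : (7 * finrank ℂ (LinearMap.ker (s 0 * s (0 + 1) - 1)) : ℂ) = 3 * finrank ℂ V := by
        push_cast at htr
        linear_combination (7 * hker + 2 * htr) / 3
      have : 7 * finrank ℂ (LinearMap.ker (s 0 * s (0 + 1) - 1)) = 3 * finrank ℂ V := by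
        exact_mod_cast this
      have hfour := h.four_dvd_finrank (by omega)
      have hVpos : 0 < finrank ℂ V := finrank_pos
      norm_num at hd'
      omega
    · obtain ⟨p, rfl⟩ : ∃ p, m = p + 2 := ⟨m - 2, by omega⟩
      refine h.false_of_jm_eq (by omega) (ih p (by omega) (by omega)) ?_ hjm htr
      rw [show (p + 2 - 1) / 2 = (p - 1) / 2 + 1 by omega, pow_succ] at hd'
      omega

end IsSpin

/-- A linear map from functions to operators which satisfies the Clifford relations on the
functions of sum zero, and whose image acts irreducibly. -/
structure CliffordRep {ι V : Type*} [Fintype ι] [AddCommGroup V] [Module ℂ V]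
    (Φ : (ι → ℂ) →ₗ[ℂ] End ℂ V) : Prop where
  anticomm : ∀ u v : ι → ℂ, ∑ i, u i = 0 → ∑ i, v i = 0 →
    Φ u * Φ v + Φ v * Φ u = (∑ i, u i * v i) • 1
  scalar : ∀ A : End ℂ V, (∀ u, ∑ i, u i = 0 → Commute (Φ u) A) → ∃ μ : ℂ, A = μ • 1

theorem quartic_of_relations {R : Type*} [Ring R] {a b c d : R}
    (haa : a * a = 1) (hbb : b * b = 1) (hcc : c * c = 1) (hdd : d * d = 1)
    (hba : b * a = -(a * b) - 1) (hcb : c * b = -(b * c) - 1) (hdc : d * c = -(c * d) - 1)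
    (hca : c * a = -(a * c)) (hda : d * a = -(a * d)) (hdb : d * b = -(b * d)) :
    (a * b * c * d) ^ 4 - (a * b * c * d) ^ 3 + (a * b * c * d) ^ 2 - a * b * c * d + 1 = 0 := by
  have haa' x : a * (a * x) = x := by rw [← mul_assoc, haa, one_mul]
  have hbb' x : b * (b * x) = x := by rw [← mul_assoc, hbb, one_mul]
  have hcc' x : c * (c * x) = x := by rw [← mul_assoc, hcc, one_mul]
  have hba' x : b * (a * x) = -(a * (b * x)) - x := by rw [← mul_assoc, hba]; noncomm_ring
  have hcb' x : c * (b * x) = -(b * (c * x)) - x := by rw [← mul_assoc, hcb]; noncomm_ring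
  have hdc' x : d * (c * x) = -(c * (d * x)) - x := by rw [← mul_assoc, hdc]; noncomm_ring
  have hca' x : c * (a * x) = -(a * (c * x)) := by rw [← mul_assoc, hca]; noncomm_ring
  have hda' x : d * (a * x) = -(a * (d * x)) := by rw [← mul_assoc, hda]; noncomm_ring
  have hdb' x : d * (b * x) = -(b * (d * x)) := by rw [← mul_assoc, hdb]; noncomm_ring
  have h2 : (a * b * c * d) ^ 2 =
      a * b * c * d + a * b + a * c + a * d + b * c + b * d + c * d + 1 := by
    simp only [pow_two, mul_assoc, haa, hbb, hcc, hdd, haa', hbb', hba', hcb', hdc', hca', hda',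
      hdb', mul_sub, mul_neg, mul_one, neg_sub]
    noncomm_ring
  rw [pow_succ _ 2, show 4 = 2 * 2 from rfl, pow_mul, h2, pow_two]
  simp only [mul_assoc, haa, hbb, hcc, hdd, hba, hcb, hdc, hca, hdb, haa', hbb', hcc',
    hba', hcb', hdc', hca', hda', hdb', mul_sub, mul_neg, mul_one, one_mul, neg_neg, neg_sub,
    mul_add, add_mul]
  noncomm_ring

theorem pow_five_of_quartic {R : Type*} [Ring R] {h : R} (hh : h ^ 4 - h ^ 3 + h ^ 2 - h + 1 = 0) :
    h ^ 5 = -1 := by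
  linear_combination (norm := noncomm_ring) h * hh + hh

namespace CliffordRep

variable {ι V : Type*} [Fintype ι] [DecidableEq ι] [AddCommGroup V] [Module ℂ V]
  {Φ : (ι → ℂ) →ₗ[ℂ] End ℂ V}

/-- The root `e_a - e_b`. -/
def root (a b : ι) : ι → ℂ := Pi.single a 1 - Pi.single b 1

theorem sum_root (a b : ι) : ∑ i, root a b i = 0 := by
  simp [root, Finset.sum_sub_distrib]

theorem sum_root_mul (a b : ι) (u : ι → ℂ) : ∑ i, root a b i * u i = u a - u b := by
  simp [root, sub_mul, Finset.sum_sub_distrib, Pi.single_apply]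

theorem sum_comp {ι : Type*} [Fintype ι] (σ : Equiv.Perm ι) {u : ι → ℂ} (hu : ∑ i, u i = 0) :
    ∑ i, (u ∘ σ) i = 0 := (Equiv.sum_comp σ u).trans hu

theorem root_mul_root (hΦ : CliffordRep Φ) {a b : ι} (hab : a ≠ b) :
    Φ (root a b) * Φ (root a b) = 1 := by
  have h := hΦ.anticomm _ _ (sum_root a b) (sum_root a b)
  rw [sum_root_mul] at h
  simp only [root, Pi.sub_apply, Pi.single_eq_same, Pi.single_eq_of_ne hab,
    Pi.single_eq_of_ne hab.symm] at h
  rw [← two_smul ℂ, show (1 - 0 - (0 - 1) : ℂ) = 2 by norm_num] at h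
  exact smul_right_injective _ (two_ne_zero (α := ℂ)) h

theorem comp_swap_eq {ι : Type*} [DecidableEq ι] (a b : ι) (u : ι → ℂ) :
    u ∘ Equiv.swap a b = u - (u a - u b) • root a b := by
  ext i
  simp only [Function.comp_apply, Pi.sub_apply, Pi.smul_apply, root, smul_eq_mul]
  by_cases h1 : i = a
  · subst h1
    by_cases h2 : i = b
    · subst h2; simp
    · simp [h2]
  · by_cases h2 : i = b
    · subst h2
      simp [h1]
    · rw [Equiv.swap_apply_of_ne_of_ne h1 h2]
      simp [h1, h2]

theorem root_mul (hΦ : CliffordRep Φ) {a b : ι} (hab : a ≠ b) {u : ι → ℂ} (hu : ∑ i, u i = 0) :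
    Φ (root a b) * Φ u = -(Φ (u ∘ Equiv.swap a b) * Φ (root a b)) := by
  have h := hΦ.anticomm _ _ (sum_root a b) hu
  rw [sum_root_mul] at h
  rw [comp_swap_eq, map_sub, map_smul, sub_mul, smul_mul_assoc, hΦ.root_mul_root hab, ← h]
  abel

theorem root_mul_root_eq (hΦ : CliffordRep Φ) (a b c d : ι) :
    Φ (root c d) * Φ (root a b) = -(Φ (root a b) * Φ (root c d)) +
      (root c d a - root c d b) • 1 := by
  rw [← sum_root_mul, ← hΦ.anticomm _ _ (sum_root a b) (sum_root c d)]
  abel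

end CliffordRep

namespace IsSpin

section Clifford

variable {V : Type*} [AddCommGroup V] [Module ℂ V] {n : ℕ} {s : ℕ → End ℂ V}

theorem mul_add_eq_ite (h : IsSpin n s) (h0 : s 0 * s 1 + s 1 * s 0 = -1) {j k : ℕ}
    (hj : j + 1 < n) (hk : k + 1 < n) :
    s k * s j + s j * s k = ((if j = k then 2 else 0) - (if j + 1 = k then 1 else 0) -
      (if j = k + 1 then 1 else 0) : ℂ) • 1 := by
  rcases lt_trichotomy j k with hjk | rfl | hjk
  · rw [if_neg hjk.ne, if_neg (by omega : ¬ j = k + 1)]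
    by_cases h1 : j + 1 = k
    · subst h1
      rw [if_pos rfl, add_comm, h.succ_mul_add h0 hk]
      norm_num
    · rw [if_neg h1, h.anti j k (by omega) hk]
      simp
  · rw [h.sq j hj]
    simp [← two_smul ℂ]
  · rw [if_neg hjk.ne', if_neg (by omega : ¬ j + 1 = k)]
    by_cases h1 : j = k + 1
    · subst h1
      rw [if_pos rfl, h.succ_mul_add h0 hj]
      norm_num
    · rw [if_neg h1, h.anti k j (by omega) hj]
      simp

theorem mul_sum_add (h : IsSpin n s) (h0 : s 0 * s 1 + s 1 * s 0 = -1) {k : ℕ}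
    (hk : k + 1 < n) : ∀ {j : ℕ}, j < n →
    s k * (∑ l ∈ Finset.range j, s l) + (∑ l ∈ Finset.range j, s l) * s k =
      ((if 0 = k then 1 else 0) + (if j = k + 1 then 1 else 0) -
        (if j = k then 1 else 0) : ℂ) • 1
  | 0, _ => by
    rcases Nat.eq_zero_or_pos k with rfl | hk0
    · simp
    · simp [hk0.ne]
  | j + 1, hj => by
    have ih := h.mul_sum_add h0 hk (j := j) (by omega)
    have h1 := h.mul_add_eq_ite h0 hj hk
    rw [Finset.sum_range_succ, mul_add, add_mul, add_add_add_comm, ih, h1, ← add_smul]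
    congr 1
    simp only [Nat.add_right_cancel_iff]
    split_ifs <;> first | omega | ring

theorem sum_mul_sum_add (h : IsSpin n s) (h0 : s 0 * s 1 + s 1 * s 0 = -1) {j : ℕ}
    (hj : j < n) : ∀ {i : ℕ}, i < n →
    (∑ l ∈ Finset.range i, s l) * (∑ l ∈ Finset.range j, s l) +
      (∑ l ∈ Finset.range j, s l) * (∑ l ∈ Finset.range i, s l) =
      (1 - (if i = 0 then 1 else 0) - (if j = 0 then 1 else 0) +
        (if j = i then 1 else 0) : ℂ) • 1
  | 0, _ => by simp
  | i + 1, hi => by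
    have ih := h.sum_mul_sum_add h0 hj (i := i) (by omega)
    have h1 := h.mul_sum_add h0 hi hj
    rw [Finset.sum_range_succ, mul_add, add_mul, add_add_add_comm, ih, h1, ← add_smul]
    congr 1
    by_cases hi0 : i = 0
    · subst hi0
      simp only [zero_add, if_true]
      simp only [one_ne_zero, if_false]
      ring
    · rw [if_neg hi0, if_neg (Ne.symm hi0), if_neg (Nat.succ_ne_zero i)]
      ring

/-- The extension of `e_k - e_{k-1} ↦ s_{k-1}` to all functions. -/
noncomputable def clifford (n : ℕ) (s : ℕ → End ℂ V) : (Fin n → ℂ) →ₗ[ℂ] End ℂ V :=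
  Fintype.linearCombination ℂ fun i : Fin n => ∑ l ∈ Finset.range i, s l

theorem clifford_apply (u : Fin n → ℂ) :
    clifford n s u = ∑ i : Fin n, u i • ∑ l ∈ Finset.range i, s l := rfl

theorem clifford_root {k : ℕ} (hk : k + 1 < n) :
    clifford n s (CliffordRep.root ⟨k + 1, hk⟩ ⟨k, by omega⟩) = s k := by
  rw [CliffordRep.root, map_sub, clifford, Fintype.linearCombination_apply_single,
    Fintype.linearCombination_apply_single, one_smul, one_smul, Finset.sum_range_succ,
    add_sub_cancel_left]

theorem clifford_anticomm (h : IsSpin n s) (h0 : s 0 * s 1 + s 1 * s 0 = -1) {u v : Fin n → ℂ}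
    (hu : ∑ i, u i = 0) (hv : ∑ i, v i = 0) :
    clifford n s u * clifford n s v + clifford n s v * clifford n s u =
      (∑ i, u i * v i) • 1 := by
  have key (i j : Fin n) : (u i • ∑ l ∈ Finset.range i, s l) * (v j • ∑ l ∈ Finset.range j, s l) +
      (v j • ∑ l ∈ Finset.range j, s l) * (u i • ∑ l ∈ Finset.range i, s l) =
      (u i * v j - (if (i : ℕ) = 0 then u i else 0) * v j - u i * (if (j : ℕ) = 0 then v j else 0) +
        (if j = i then u i * v j else 0)) • (1 : End ℂ V) := by
    rw [smul_mul_smul_comm, smul_mul_smul_comm, mul_comm (v j), ← smul_add,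
      h.sum_mul_sum_add h0 j.2 i.2, smul_smul]
    congr 1
    simp only [Fin.ext_iff]
    split_ifs <;> ring
  rw [clifford_apply, clifford_apply, Finset.sum_mul_sum, Finset.sum_mul_sum,
    Finset.sum_comm (f := fun i j : Fin n => (v i • ∑ l ∈ Finset.range i, s l) *
      (u j • ∑ l ∈ Finset.range j, s l)), ← Finset.sum_add_distrib]
  simp_rw [← Finset.sum_add_distrib, key, ← Finset.sum_smul, Finset.sum_add_distrib,
    Finset.sum_sub_distrib, ← Finset.mul_sum, ← Finset.sum_mul]
  simp [hu, hv]

theorem cliffordRep [FiniteDimensional ℂ V] [Nontrivial V] (h : IsSpin n s)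
    (h0 : s 0 * s 1 + s 1 * s 0 = -1) (hirr : Irred n s) : CliffordRep (clifford n s) where
  anticomm _ _ hu hv := h.clifford_anticomm h0 hu hv
  scalar A hA := hirr.exists_eq_smul fun i hi => by
    rw [← clifford_root (s := s) hi]
    exact hA _ (CliffordRep.sum_root _ _)

end Clifford
end IsSpin

namespace Schur

theorem z_mul_z (n : ℕ) : z n * z n = 1 := by
  have := PresentedGroup.one_of_mem (rels := rels n) (x := zf n ^ 2) (Or.inl rfl)
  rwa [map_pow, pow_two] at this

theorem t_mul_t {n : ℕ} (i : Fin (n - 1)) : t n i * t n i = z n := by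
  have := PresentedGroup.one_of_mem (rels := rels n) (x := tf n i ^ 2 * (zf n)⁻¹)
    (Or.inr <| Or.inl ⟨i, rfl⟩)
  rwa [map_mul, map_inv, mul_inv_eq_one, map_pow, pow_two] at this

theorem t_mul_t_pow_three {n : ℕ} {i j : Fin (n - 1)} (hij : (i : ℕ) + 1 = j) :
    (t n i * t n j) ^ 3 = z n := by
  have := PresentedGroup.one_of_mem (rels := rels n) (x := (tf n i * tf n j) ^ 3 * (zf n)⁻¹)
    (Or.inr <| Or.inr <| Or.inl ⟨i, j, hij, rfl⟩)
  rwa [map_mul, map_inv, mul_inv_eq_one, map_pow, map_mul] at this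

theorem t_mul_t_pow_two {n : ℕ} {i j : Fin (n - 1)} (hij : (i : ℕ) + 2 ≤ j) :
    (t n i * t n j) ^ 2 = z n := by
  have := PresentedGroup.one_of_mem (rels := rels n) (x := (tf n i * tf n j) ^ 2 * (zf n)⁻¹)
    (Or.inr <| Or.inr <| Or.inr ⟨i, j, Or.inl hij, rfl⟩)
  rwa [map_mul, map_inv, mul_inv_eq_one, map_pow, map_mul] at this

theorem cover_induction {n : ℕ} {P : Cover n → Prop} (hz : P (z n)) (ht : ∀ i, P (t n i))
    (hmul : ∀ g h, P g → P h → P (g * h)) (g : Cover n) : P g := by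
  have h1 : P 1 := z_mul_z n ▸ hmul _ _ hz hz
  have hg : g ∈ Subgroup.closure (Set.range (PresentedGroup.of (rels := rels n))) := by
    rw [PresentedGroup.closure_range_of]; trivial
  suffices P g ∧ P g⁻¹ from this.1
  induction hg using Subgroup.closure_induction with
  | mem x hx =>
    obtain ⟨_ | i, rfl⟩ := hx
    · change P (z n) ∧ P (z n)⁻¹
      exact ⟨hz, by rwa [inv_eq_of_mul_eq_one_right (z_mul_z n)]⟩
    · change P (t n i) ∧ P (t n i)⁻¹
      refine ⟨ht i, ?_⟩
      rw [inv_eq_of_mul_eq_one_right (b := t n i * z n) (by rw [← mul_assoc, t_mul_t, z_mul_z])]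
      exact hmul _ _ (ht i) hz
  | one => simpa using h1
  | mul x y _ _ hx hy => exact ⟨hmul _ _ hx.1 hy.1, mul_inv_rev x y ▸ hmul _ _ hy.2 hx.2⟩
  | inv x _ hx => exact ⟨hx.2, (inv_inv x).symm ▸ hx.1⟩

variable {n : ℕ} {V : Type*} [AddCommGroup V] [Module ℂ V]

/-- The generators of a spin representation, normalised to be involutions. -/
noncomputable def gen (ρ : Cover n →* End ℂ V) (i : ℕ) : End ℂ V :=
  if h : i < n - 1 then Complex.I • ρ (t n ⟨i, h⟩) else 0

theorem gen_eq (ρ : Cover n →* End ℂ V) {i : ℕ} (hi : i + 1 < n) :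
    gen ρ i = Complex.I • ρ (t n ⟨i, by omega⟩) := dif_pos _

theorem map_t (ρ : Cover n →* End ℂ V) (i : Fin (n - 1)) :
    ρ (t n i) = -Complex.I • gen ρ i := by
  rw [gen_eq ρ (by omega), smul_smul, neg_mul, Complex.I_mul_I, neg_neg, one_smul]

theorem isSpin_gen {ρ : Cover n →* End ℂ V} (hρ : ρ (z n) = -1) : IsSpin n (gen ρ) := by
  have hsq : ∀ i, i + 1 < n → gen ρ i * gen ρ i = 1 := fun i hi => by
    rw [gen_eq ρ hi, smul_mul_smul_comm, Complex.I_mul_I, ← map_mul, t_mul_t, hρ]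
    simp
  have hmul {i j : ℕ} (hi : i + 1 < n) (hj : j + 1 < n) : gen ρ i * gen ρ j =
      (-1 : ℂ) • ρ (t n ⟨i, by omega⟩ * t n ⟨j, by omega⟩) := by
    rw [gen_eq ρ hi, gen_eq ρ hj, smul_mul_smul_comm, Complex.I_mul_I, ← map_mul]
  refine ⟨hsq, fun i hi => ?_, fun i j hij hj => ?_⟩
  · have h1 := hsq i (by omega)
    have h2 := hsq (i + 1) (by omega)
    have h3 : (gen ρ i * gen ρ (i + 1)) ^ 3 = 1 := by
      rw [hmul (by omega) (by omega), smul_pow, ← map_pow, t_mul_t_pow_three rfl, hρ]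
      norm_num
    linear_combination (norm := noncomm_ring) h3 * gen ρ (i + 1) * gen ρ i * gen ρ (i + 1) -
      gen ρ i * gen ρ (i + 1) * gen ρ i * gen ρ (i + 1) * gen ρ i * h2 * gen ρ i * gen ρ (i + 1) -
      gen ρ i * gen ρ (i + 1) * gen ρ i * gen ρ (i + 1) * h1 * gen ρ (i + 1) -
      gen ρ i * gen ρ (i + 1) * gen ρ i * h2
  · have h1 := hsq i (by omega)
    have h2 := hsq j (by omega)
    have h3 : (gen ρ i * gen ρ j) ^ 2 = -1 := by
      rw [hmul (by omega) (by omega), smul_pow, ← map_pow, t_mul_t_pow_two hij, hρ]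
      norm_num
    linear_combination (norm := noncomm_ring) h3 * gen ρ j * gen ρ i -
      gen ρ i * gen ρ j * gen ρ i * h2 * gen ρ i - gen ρ i * gen ρ j * h1

theorem irred_gen {ρ : Cover n →* End ℂ V} (hρ : ρ (z n) = -1)
    (hirr : ∀ U : Submodule ℂ V, (∀ h : Cover n, U.map (ρ h) ≤ U) → U = ⊥ ∨ U = ⊤) :
    IsSpin.Irred n (gen ρ) := by
  refine fun U hU => hirr U fun h => ?_
  induction h using cover_induction with
  | hz => rw [hρ]; rintro _ ⟨v, hv, rfl⟩; exact U.neg_mem hv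
  | ht i =>
    rw [map_t]
    rintro _ ⟨v, hv, rfl⟩
    exact U.smul_mem _ (hU i (by omega) v hv)
  | hmul g h hg hh =>
    rintro _ ⟨v, hv, rfl⟩
    rw [map_mul]
    exact hg ⟨_, hh ⟨v, hv, rfl⟩, rfl⟩

theorem det_pow_four {ρ : Cover n →* End ℂ V} (hρ : ρ (z n) = -1) (g : Cover n) :
    LinearMap.det (ρ g) ^ 4 = 1 := by
  have hz : ρ (z n) ^ 2 = 1 := by rw [hρ]; norm_num
  induction g using cover_induction with
  | hz => rw [← map_pow, pow_mul _ 2 2, hz, one_pow, map_one]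
  | ht i =>
    rw [← map_pow, pow_mul _ 2 2, ← map_pow ρ, pow_two (t n i), t_mul_t, hz, map_one]
  | hmul g h hg hh => rw [map_mul, map_mul, mul_pow, hg, hh, one_mul]

theorem map_mul_clifford {ρ : Cover n →* End ℂ V} (hρ : ρ (z n) = -1)
    {π : Cover n →* Equiv.Perm (Fin n)} (hπt : ∀ i : Fin (n - 1), π (t n i) = adj n i)
    (hπz : π (z n) = 1) (hΦ : CliffordRep (IsSpin.clifford n (gen ρ))) (g : Cover n)
    {u : Fin n → ℂ} (hu : ∑ i, u i = 0) :
    ρ g * IsSpin.clifford n (gen ρ) u = ((Equiv.Perm.sign (π g) : ℤ) : ℂ) •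
      (IsSpin.clifford n (gen ρ) (u ∘ ⇑(π g)⁻¹) * ρ g) := by
  induction g using cover_induction generalizing u with
  | hz => simp [hρ, hπz]
  | ht i =>
    have hi : (i : ℕ) + 1 < n := by omega
    have hne : (⟨i + 1, hi⟩ : Fin n) ≠ ⟨i, by omega⟩ := by simp
    have h1 := hΦ.root_mul hne hu
    rw [IsSpin.clifford_root] at h1
    rw [map_t, hπt, adj, Equiv.swap_inv, Equiv.Perm.sign_swap hne.symm, smul_mul_assoc, h1,
      Equiv.swap_comm]
    simp
  | hmul g h hg hh =>
    rw [map_mul, map_mul, mul_assoc, hh hu, mul_smul_comm, ← mul_assoc,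
      hg (CliffordRep.sum_comp _ hu), Equiv.Perm.sign_mul, mul_inv_rev, smul_mul_assoc, smul_smul,
      mul_assoc]
    push_cast
    rw [mul_comm (((Equiv.Perm.sign (π h) : ℤˣ) : ℤ) : ℂ)]
    rfl

theorem cliffordRep_gen {V : Type} [AddCommGroup V] [Module ℂ V] [FiniteDimensional ℂ V]
    [Nontrivial V] (hn : 7 ≤ n) {ρ : Cover n →* End ℂ V} (hρ : ρ (z n) = -1)
    (hirr : ∀ U : Submodule ℂ V, (∀ h : Cover n, U.map (ρ h) ≤ U) → U = ⊥ ∨ U = ⊤)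
    (hdim : finrank ℂ V = 2 ^ ((n - 1) / 2)) :
    CliffordRep (IsSpin.clifford n (gen ρ)) := by
  have h := isSpin_gen hρ
  exact h.cliffordRep ((IsSpin.basicAt n hn V (gen ρ) h hdim.le).mul_add h (by omega))
    (irred_gen hρ hirr)

end Schur

namespace CliffordRep

variable {ι V : Type*} [Fintype ι] [DecidableEq ι] [AddCommGroup V] [Module ℂ V]
  {Φ : (ι → ℂ) →ₗ[ℂ] End ℂ V}

/-- `G` is a lift of the permutation `σ` to an operator of the spin representation. -/
def Lifts (Φ : (ι → ℂ) →ₗ[ℂ] End ℂ V) (G : End ℂ V) (σ : Equiv.Perm ι) : Prop :=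
  ∀ u : ι → ℂ, ∑ i, u i = 0 →
    G * Φ u = ((Equiv.Perm.sign σ : ℤ) : ℂ) • (Φ (u ∘ ⇑σ⁻¹) * G)

theorem Lifts.mul {G H : End ℂ V} {σ τ : Equiv.Perm ι} (hG : Lifts Φ G σ) (hH : Lifts Φ H τ) :
    Lifts Φ (G * H) (σ * τ) := fun u hu => by
  rw [mul_assoc, hH u hu, mul_smul_comm, ← mul_assoc,
    hG _ (sum_comp _ hu), Equiv.Perm.sign_mul, mul_inv_rev, smul_mul_assoc, smul_smul, mul_assoc]
  push_cast
  rw [mul_comm (((Equiv.Perm.sign τ : ℤˣ) : ℤ) : ℂ)]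
  rfl

theorem Lifts.pow {G : End ℂ V} {σ : Equiv.Perm ι} (hG : Lifts Φ G σ) :
    ∀ m : ℕ, Lifts Φ (G ^ m) (σ ^ m)
  | 0 => fun u _ => by simp
  | m + 1 => by
    rw [pow_succ, pow_succ]
    exact (hG.pow m).mul hG

theorem lifts_root (hΦ : CliffordRep Φ) {a b : ι} (hab : a ≠ b) :
    Lifts Φ (Φ (root a b)) (Equiv.swap a b) := fun u hu => by
  rw [hΦ.root_mul hab hu, Equiv.Perm.sign_swap hab, Equiv.swap_inv]
  simp

theorem Lifts.exists_eq_smul (hΦ : CliffordRep Φ) {G H G' : End ℂ V} {σ : Equiv.Perm ι}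
    (hG : Lifts Φ G σ) (hH : Lifts Φ H σ) (h1 : G * G' = 1) (h2 : G' * G = 1) :
    ∃ μ : ℂ, H = μ • G := by
  obtain ⟨μ, hμ⟩ := hΦ.scalar (G' * H) fun u hu => by
    have h3 : G * (G' * H) = H := by rw [← mul_assoc, h1, one_mul]
    have h4 : G * (Φ u * (G' * H)) = G * (G' * H * Φ u) := by
      rw [← mul_assoc, hG u hu, smul_mul_assoc, mul_assoc (Φ _), h3, ← hH u hu, ← mul_assoc, h3]
    have h5 := congrArg (G' * ·) h4
    simp only [← mul_assoc, h2, one_mul] at h5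
    simpa only [Commute, SemiconjBy, mul_assoc] using h5
  refine ⟨μ, ?_⟩
  have h3 := congrArg (G * ·) hμ
  simpa [← mul_assoc, h1] using h3

theorem Lifts.eq_zero_of_five_cycle [FiniteDimensional ℂ V] (hΦ : CliffordRep Φ) {e : ℕ}
    (hdim : finrank ℂ V = 2 ^ e) {K : End ℂ V} {τ : Equiv.Perm ι} (hK : Lifts Φ K τ)
    (hτ : τ.IsCycle) (hcard : τ.support.card = 5) {ε : ℂ} (hε : ε ^ 2 = 1)
    (hKε : K ^ 5 = ε • 1) (hdet : LinearMap.det K ^ 4 = 1) {v : V} (hv : K v = ε • v) :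
    v = 0 := by
  have hnt : Nontrivial V := Module.nontrivial_of_finrank_pos (R := ℂ) (by rw [hdim]; positivity)
  obtain ⟨x, hx, -⟩ := id hτ
  have hform := Equiv.Perm.formPerm_toList τ x
  rw [hτ.cycleOf_eq hx] at hform
  have hnd := Equiv.Perm.nodup_toList τ x
  have hlen := Equiv.Perm.length_toList τ x
  rw [hτ.cycleOf_eq hx, hcard] at hlen
  obtain ⟨a, b, c, d, f, hl⟩ : ∃ a b c d f, Equiv.Perm.toList τ x = [a, b, c, d, f] := by
    match Equiv.Perm.toList τ x, hlen with
    | [a, b, c, d, f], _ => exact ⟨a, b, c, d, f, rfl⟩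
  rw [hl] at hform hnd
  simp only [List.formPerm_cons_cons, List.formPerm_singleton, mul_one] at hform
  simp only [List.nodup_cons, List.mem_cons, List.not_mem_nil, not_or] at hnd
  obtain ⟨⟨hab, hac, had, haf, -⟩, ⟨hbc, hbd, hbf, -⟩, ⟨hcd, hcf, -⟩, ⟨hdf, -⟩, -⟩ := hnd
  have hquart := quartic_of_relations (hΦ.root_mul_root hab) (hΦ.root_mul_root hbc)
    (hΦ.root_mul_root hcd) (hΦ.root_mul_root hdf)
    (by rw [hΦ.root_mul_root_eq]; simp [root, *, sub_eq_add_neg])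
    (by rw [hΦ.root_mul_root_eq]; simp [root, *, sub_eq_add_neg])
    (by rw [hΦ.root_mul_root_eq]; simp [root, *, sub_eq_add_neg])
    (by rw [hΦ.root_mul_root_eq]; simp [root, *])
    (by rw [hΦ.root_mul_root_eq]; simp [root, *])
    (by rw [hΦ.root_mul_root_eq]; simp [root, *])
  have hlift := (((hΦ.lifts_root hab).mul (hΦ.lifts_root hbc)).mul (hΦ.lifts_root hcd)).mul
    (hΦ.lifts_root hdf)
  have hsq : (LinearMap.det (Φ (root a b) * Φ (root b c) * Φ (root c d) * Φ (root d f))) ^ 2 =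
      1 := by
    have h1 {a b : ι} (hab : a ≠ b) : LinearMap.det (Φ (root a b)) ^ 2 = 1 := by
      rw [pow_two, ← map_mul, hΦ.root_mul_root hab, map_one]
    simp only [map_mul, mul_pow, h1 hab, h1 hbc, h1 hcd, h1 hdf, one_mul]
  rw [mul_assoc _ (Equiv.swap c d), mul_assoc _ (Equiv.swap b c), hform] at hlift
  generalize Φ (root a b) * Φ (root b c) * Φ (root c d) * Φ (root d f) = h at hquart hlift hsq
  obtain ⟨κ, rfl⟩ := hK.exists_eq_smul hΦ hlift (G' := ε • K ^ 4)
    (by rw [mul_smul_comm, ← pow_succ', hKε, smul_smul, ← pow_two, hε, one_smul])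
    (by rw [smul_mul_assoc, ← pow_succ, hKε, smul_smul, ← pow_two, hε, one_smul])
  have h5 : κ ^ 5 * ε = -1 := by
    have h5 := pow_five_of_quartic hquart
    rw [smul_pow, hKε, smul_smul] at h5
    obtain ⟨w, hw⟩ := exists_ne (0 : V)
    have h6 := congrArg (· w) h5
    have h7 : (κ ^ 5 * ε) • w = (-1 : ℂ) • w := by simpa using h6
    exact smul_left_injective ℂ hw h7
  have h10 : κ ^ 10 = 1 := by linear_combination (κ ^ 5 * ε - 1) * h5 - κ ^ 10 * hε
  have hpow : κ ^ (2 ^ (e + 2)) = 1 := by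
    rw [LinearMap.det_smul, hdim, mul_pow, ← pow_mul, ← pow_succ] at hsq
    have := congrArg (· ^ 2) hsq
    simp only [mul_pow, ← pow_mul, hdet, one_pow] at this
    simpa [pow_succ, hdet] using this
  have h2 : κ ^ 2 = 1 := by
    have h1 : orderOf κ ∣ Nat.gcd 10 (2 ^ (e + 2)) :=
      Nat.dvd_gcd (orderOf_dvd_of_pow_eq_one h10) (orderOf_dvd_of_pow_eq_one hpow)
    have h3 : Nat.gcd 10 (2 ^ (e + 2)) = 2 := by
      rw [pow_succ', show 10 = 2 * 5 from rfl, Nat.gcd_mul_left,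
        (Nat.Coprime.pow_right _ (by norm_num) : Nat.Coprime 5 (2 ^ (e + 1)))]
    exact orderOf_dvd_iff_pow_eq_one.1 (h3 ▸ h1)
  have hκε : κ * ε = -1 := by linear_combination h5 - (κ ^ 3 + κ) * ε * h2
  have hv1 : (κ • K) v = -v := by
    rw [LinearMap.smul_apply, hv, smul_smul, hκε, neg_one_smul]
  have := congrArg (· v) hquart
  simp only [LinearMap.add_apply, LinearMap.sub_apply, pow_succ, pow_zero, one_mul,
    Module.End.mul_apply, hv1, map_neg, Module.End.one_apply, LinearMap.zero_apply] at this
  have h5v : (5 : ℂ) • v = 0 := by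
    rw [← this]
    module
  simpa using h5v

end CliffordRep

namespace Equiv.Perm

variable {ι : Type*} [Fintype ι] [DecidableEq ι] {σ : Perm ι}

theorem pow_apply_eq_self_iff_card_dvd {c : Perm ι} (hc : c ∈ σ.cycleFactorsFinset) {x : ι}
    (hx : x ∈ c.support) (p : ℕ) : (σ ^ p) x = x ↔ c.support.card ∣ p := by
  have hcy := (mem_cycleFactorsFinset_iff.1 hc).1
  have hc' := cycle_is_cycleOf hx hc
  rw [← cycleOf_pow_apply_self, ← hc', ← hcy.orderOf, orderOf_dvd_iff_pow_eq_one,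
    hcy.pow_eq_one_iff' (mem_support.1 hx)]

theorem orderOf_dvd_iff_card_dvd {k : ℕ} :
    orderOf σ ∣ k ↔ ∀ c ∈ σ.cycleFactorsFinset, c.support.card ∣ k := by
  rw [← lcm_cycleType, Multiset.lcm_dvd, cycleType_def]
  simp

theorem card_dvd_orderOf {c : Perm ι} (hc : c ∈ σ.cycleFactorsFinset) :
    c.support.card ∣ orderOf σ := orderOf_dvd_iff_card_dvd.1 dvd_rfl c hc

theorem isCycle_pow_of_card_dvd {c : Perm ι} {p r : ℕ}
    (hp : p.Prime) (hcard : c.support.card = p)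
    (hr : ∀ d ∈ σ.cycleFactorsFinset, d ≠ c → d.support.card ∣ r) (hord : orderOf (σ ^ r) = p) :
    (σ ^ r).IsCycle ∧ (σ ^ r).support.card = p := by
  have hle : (σ ^ r).support ⊆ c.support := fun x hx => by
    by_contra hxc
    rw [mem_support] at hx
    by_cases hx' : x ∈ σ.support
    · have hd : cycleOf σ x ∈ σ.cycleFactorsFinset := cycleOf_mem_cycleFactorsFinset_iff.2 hx'
      have hxd : x ∈ (cycleOf σ x).support := mem_support_cycleOf_iff.2 ⟨SameCycle.refl _ _, hx'⟩
      exact hx ((pow_apply_eq_self_iff_card_dvd hd hxd r).2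
        (hr _ hd fun h => hxc (h ▸ hxd)))
    · exact hx (pow_apply_eq_self_of_apply_eq_self (notMem_support.1 hx') r)
  have h1 := Finset.card_le_card hle
  have hcy : (σ ^ r).IsCycle := isCycle_of_prime_order (by rwa [hord]) (by
    rw [hord]; have := hp.pos; omega)
  exact ⟨hcy, hcy.orderOf ▸ hord⟩

end Equiv.Perm

theorem Schur.solitaryPart_iff {ι : Type*} [Fintype ι] [DecidableEq ι] {σ : Equiv.Perm ι}
    {d : ℕ} : SolitaryPart d σ ↔ ∃ c ∈ σ.cycleFactorsFinset, c.support.card = d ∧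
      ∀ c' ∈ σ.cycleFactorsFinset, d ∣ c'.support.card → c' = c := by
  rw [SolitaryPart, Equiv.Perm.cycleType_def, Multiset.filter_map, Multiset.map_eq_singleton]
  refine exists_congr fun c => ?_
  rw [← Finset.filter_val, ← Finset.singleton_val, Finset.val_inj, Finset.ext_iff]
  simp only [Finset.mem_filter, Finset.mem_singleton, Function.comp_apply]
  constructor
  · rintro ⟨h1, h2⟩
    exact ⟨((h1 c).2 rfl).1, h2, fun c' h3 h4 => (h1 c').1 ⟨h3, h4⟩⟩
  · rintro ⟨h1, h2, h3⟩
    refine ⟨fun c' => ⟨fun h => h3 c' h.1 h.2, ?_⟩, h2⟩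
    rintro rfl
    exact ⟨h1, h2.symm.dvd⟩

namespace Equiv.Perm

variable {ι : Type*} {σ : Perm ι}

open Classical in
/-- The function on the cycle of `x` with `σ ^ p • x ↦ θ ^ p`. -/
noncomputable def eigenfun (σ : Perm ι) (x : ι) (θ : ℂ) (i : ι) : ℂ :=
  if h : ∃ p : ℕ, (σ ^ p) x = i then θ ^ h.choose else 0

theorem eigenfun_eq_zero {x i : ι} (h : ¬ σ.SameCycle x i) (θ : ℂ) : eigenfun σ x θ i = 0 :=
  dif_neg fun ⟨p, hp⟩ => h ⟨p, by simpa using hp⟩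

variable {x : ι} {θ : ℂ}

theorem eigenfun_pow_apply (hθ : ∀ p : ℕ, (σ ^ p) x = x → θ ^ p = 1) (p : ℕ) :
    eigenfun σ x θ ((σ ^ p) x) = θ ^ p := by
  have key {p q : ℕ} (hpq : p ≤ q) (h : (σ ^ p) x = (σ ^ q) x) : θ ^ p = θ ^ q := by
    obtain ⟨m, rfl⟩ := Nat.exists_eq_add_of_le hpq
    rw [pow_add, mul_apply] at h
    rw [pow_add, hθ m ((σ ^ p).injective h).symm, mul_one]
  have hex : ∃ q : ℕ, (σ ^ q) x = (σ ^ p) x := ⟨p, rfl⟩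
  rw [eigenfun, dif_pos hex]
  rcases le_total hex.choose p with h | h
  · exact key h hex.choose_spec
  · exact (key h hex.choose_spec.symm).symm

variable [Fintype ι]

theorem sum_eq_zero_of_apply_inv {f : ι → ℂ} {η : ℂ} (hf : ∀ i, f (σ⁻¹ i) = η * f i)
    (hη : η ≠ 1) : ∑ i, f i = 0 := by
  have h1 : ∑ i, f (σ⁻¹ i) = ∑ i, f i := Equiv.sum_comp σ⁻¹ f
  simp_rw [hf, ← Finset.mul_sum] at h1
  by_contra h
  exact hη (mul_right_cancel₀ h (by rw [h1, one_mul]))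

theorem ne_zero_of_forall_pow (hθ : ∀ p : ℕ, (σ ^ p) x = x → θ ^ p = 1) : θ ≠ 0 := by
  rintro rfl
  have h := hθ (orderOf σ) (by rw [pow_orderOf_eq_one]; rfl)
  rw [zero_pow (orderOf_pos σ).ne'] at h
  exact zero_ne_one h

theorem eigenfun_inv_apply (hθ : ∀ p : ℕ, (σ ^ p) x = x → θ ^ p = 1) (i : ι) :
    eigenfun σ x θ (σ⁻¹ i) = θ⁻¹ * eigenfun σ x θ i := by
  by_cases h : σ.SameCycle x i
  · classical
    obtain ⟨p, hp, -, rfl⟩ := h.exists_pow_eq''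
    obtain ⟨p, rfl⟩ := Nat.exists_eq_add_of_le' hp
    rw [eigenfun_pow_apply hθ, pow_succ', mul_apply, coe_inv, symm_apply_apply,
      eigenfun_pow_apply hθ,
      pow_succ', inv_mul_cancel_left₀ (ne_zero_of_forall_pow hθ)]
  · rw [eigenfun_eq_zero h, eigenfun_eq_zero (fun h' => h (h'.trans ⟨1, by simp⟩)), mul_zero]

theorem sum_eigenfun (hθ : ∀ p : ℕ, (σ ^ p) x = x → θ ^ p = 1) (h1 : θ ≠ 1) :
    ∑ i, eigenfun σ x θ i = 0 :=
  sum_eq_zero_of_apply_inv (eigenfun_inv_apply hθ) (inv_ne_one.2 h1)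

theorem sum_eigenfun_mul (hθ : ∀ p : ℕ, (σ ^ p) x = x → θ ^ p = 1) {y : ι} {η : ℂ}
    (hη : ∀ p : ℕ, (σ ^ p) y = y → η ^ p = 1) (h : σ.SameCycle x y → θ * η ≠ 1) :
    ∑ i, eigenfun σ x θ i * eigenfun σ y η i = 0 := by
  by_cases hxy : σ.SameCycle x y
  · refine sum_eq_zero_of_apply_inv (σ := σ) (η := (θ * η)⁻¹) (fun i => ?_) (inv_ne_one.2 (h hxy))
    rw [eigenfun_inv_apply hθ, eigenfun_inv_apply hη]
    ring
  · refine Finset.sum_eq_zero fun i _ => ?_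
    by_cases hxi : σ.SameCycle x i
    · rw [eigenfun_eq_zero fun hyi : σ.SameCycle y i => hxy (hxi.trans hyi.symm), mul_zero]
    · rw [eigenfun_eq_zero hxi, zero_mul]

theorem sum_eigenfun_mul_inv_ne_zero (hθ : ∀ p : ℕ, (σ ^ p) x = x → θ ^ p = 1) :
    ∑ i, eigenfun σ x θ i * eigenfun σ x θ⁻¹ i ≠ 0 := by
  classical
  have hθ' : ∀ p : ℕ, (σ ^ p) x = x → θ⁻¹ ^ p = 1 := fun p hp => by rw [inv_pow, hθ p hp, inv_one]
  have key (i : ι) : eigenfun σ x θ i * eigenfun σ x θ⁻¹ i = if σ.SameCycle x i then 1 else 0 := by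
    by_cases h : σ.SameCycle x i
    · obtain ⟨p, -, -, rfl⟩ := h.exists_pow_eq''
      rw [if_pos h, eigenfun_pow_apply hθ, eigenfun_pow_apply hθ', inv_pow,
        mul_inv_cancel₀ (pow_ne_zero _ (ne_zero_of_forall_pow hθ))]
    · rw [if_neg h, eigenfun_eq_zero h, zero_mul]
  simp_rw [key, Finset.sum_boole]
  exact Nat.cast_ne_zero.2 (Finset.card_ne_zero.2 ⟨x, by simp [SameCycle.refl]⟩)

end Equiv.Perm

section Fock

variable {V κ : Type*} [AddCommGroup V] [Module ℂ V] {J : Finset κ} {a b : κ → End ℂ V}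

/-- A family of anticommuting annihilation operators has a common vacuum vector. -/
theorem exists_vacuum [Nontrivial V]
    (hbb : ∀ i ∈ J, ∀ j ∈ J, b i * b j + b j * b i = 0) :
    ∃ v : V, v ≠ 0 ∧ ∀ i ∈ J, b i v = 0 := by
  classical
  induction J using Finset.induction_on with
  | empty => simpa using exists_ne (0 : V)
  | insert j J hj ih =>
    obtain ⟨v, hv, hvJ⟩ := ih fun i hi k hk =>
      hbb i (Finset.mem_insert_of_mem hi) k (Finset.mem_insert_of_mem hk)
    by_cases hjv : b j v = 0
    · exact ⟨v, hv, Finset.forall_mem_insert _ _ _ |>.2 ⟨hjv, hvJ⟩⟩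
    · refine ⟨b j v, hjv, Finset.forall_mem_insert _ _ _ |>.2 ⟨?_, fun i hi => ?_⟩⟩
      · have h1 := congrArg (· v) (hbb j (Finset.mem_insert_self j J) j (Finset.mem_insert_self j J))
        have h2 : b j (b j v) + b j (b j v) = 0 := h1
        rwa [← two_smul ℂ, smul_eq_zero_iff_right two_ne_zero] at h2
      · have h1 := congrArg (· v) (hbb i (Finset.mem_insert_of_mem hi) j (Finset.mem_insert_self j J))
        have h2 : b i (b j v) + b j (b i v) = 0 := h1
        rwa [hvJ i hi, map_zero, add_zero] at h2

theorem exists_eigenvalue_mul_prod [FiniteDimensional ℂ V] [Nontrivial V] {G : End ℂ V}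
    {α β c : κ → ℂ} (hbb : ∀ i ∈ J, ∀ j ∈ J, b i * b j + b j * b i = 0)
    (hab : ∀ i ∈ J, ∀ j ∈ J, i ≠ j → a i * b j + b j * a i = 0)
    (hc : ∀ i ∈ J, a i * b i + b i * a i = c i • 1) (hc0 : ∀ i ∈ J, c i ≠ 0)
    (hGa : ∀ i ∈ J, G * a i = α i • (a i * G)) (hGb : ∀ i ∈ J, G * b i = β i • (b i * G))
    (hβ : ∀ i ∈ J, β i ≠ 0) :
    ∃ μ : ℂ, ∀ S ⊆ J, G.HasEigenvalue (μ * ∏ i ∈ S, α i) := by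
  classical
  obtain ⟨w, hw, hwJ⟩ := exists_vacuum hbb
  let U : Submodule ℂ V := ⨅ i ∈ J, LinearMap.ker (b i)
  have hmem (v : V) : v ∈ U ↔ ∀ i ∈ J, b i v = 0 := by simp [U]
  obtain ⟨μ, v, hvU, hv0, hv⟩ := exists_eigenvector_mem (U := U) (A := G)
    (fun h => hw ((Submodule.mem_bot ℂ).1 (h ▸ (hmem w).2 hwJ)))
    (fun v hv => (hmem _).2 fun i hi => by
      have h1 := congrArg (· v) (hGb i hi)
      have h2 : G (b i v) = β i • b i (G v) := h1
      rw [(hmem v).1 hv i hi, map_zero, eq_comm, smul_eq_zero_iff_right (hβ i hi)] at h2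
      exact h2)
  refine ⟨μ, fun S hS => ?_⟩
  suffices ∃ w : V, w ≠ 0 ∧ G w = (μ * ∏ i ∈ S, α i) • w ∧ ∀ i ∈ J, i ∉ S → b i w = 0 by
    obtain ⟨w, hw, hGw, -⟩ := this
    exact Module.End.hasEigenvalue_of_hasEigenvector (x := w)
      ⟨Module.End.mem_eigenspace_iff.2 hGw, hw⟩
  induction S using Finset.induction_on with
  | empty => exact ⟨v, hv0, by simpa using hv, fun i hi _ => (hmem v).1 hvU i hi⟩
  | insert j S hj ih =>
    obtain ⟨w, hw, hGw, hb⟩ := ih ((Finset.subset_insert j S).trans hS)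
    have hjJ := hS (Finset.mem_insert_self j S)
    refine ⟨a j w, fun h => ?_, ?_, fun i hi his => ?_⟩
    · have h1 := congrArg (· w) (hc j hjJ)
      have h2 : a j (b j w) + b j (a j w) = c j • w := h1
      rw [h, hb j hjJ hj, map_zero, map_zero, add_zero, eq_comm,
        smul_eq_zero_iff_right (hc0 j hjJ)] at h2
      exact hw h2
    · have h1 := congrArg (· w) (hGa j hjJ)
      have h2 : G (a j w) = α j • a j (G w) := h1
      rw [h2, hGw, map_smul, smul_smul, Finset.prod_insert hj]
      congr 1
      ring
    · rw [Finset.mem_insert, not_or] at his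
      have h1 := congrArg (· w) (hab j hjJ i hi (Ne.symm his.1))
      have h2 : a j (b i w) + b i (a j w) = 0 := h1
      rwa [hb i hi his.2, map_zero, zero_add] at h2

theorem hasEigenvalue_neg {a b G : End ℂ V} {c : ℂ} (hc0 : c ≠ 0) (hab : a * b + b * a = c • 1)
    (ha : G * a = -(a * G)) (hb : G * b = -(b * G)) {μ : ℂ} (hμ : G.HasEigenvalue μ) :
    G.HasEigenvalue (-μ) := by
  obtain ⟨v, hv, hv0⟩ := hμ.exists_hasEigenvector
  rw [Module.End.mem_eigenspace_iff] at hv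
  have key {a : End ℂ V} (ha : G * a = -(a * G)) (h : a v ≠ 0) : G.HasEigenvalue (-μ) := by
    refine Module.End.hasEigenvalue_of_hasEigenvector (x := a v)
      ⟨Module.End.mem_eigenspace_iff.2 ?_, h⟩
    have h1 : G (a v) = -(a (G v)) := congrArg (· v) ha
    rw [h1, hv, map_smul, neg_smul]
  by_cases h : a v = 0
  · refine key hb fun hbv => ?_
    have h1 : a (b v) + b (a v) = c • v := congrArg (· v) hab
    rw [h, hbv, map_zero, map_zero, add_zero, eq_comm, smul_eq_zero_iff_right hc0] at h1
    exact hv0 h1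
  · exact key ha h

end Fock

namespace CliffordRep

open Equiv.Perm

variable {ι V : Type*} [Fintype ι] [DecidableEq ι] [AddCommGroup V] [Module ℂ V]
  {Φ : (ι → ℂ) →ₗ[ℂ] End ℂ V} {G : End ℂ V} {σ : Equiv.Perm ι}

theorem Lifts.mul_map (hG : Lifts Φ G σ) {u : ι → ℂ} (hu : ∑ i, u i = 0) {η : ℂ}
    (hη : ∀ i, u (σ⁻¹ i) = η * u i) :
    G * Φ u = (((sign σ : ℤ) : ℂ) * η) • (Φ u * G) := by
  rw [hG u hu, show u ∘ ⇑σ⁻¹ = η • u from funext hη, map_smul, smul_mul_assoc, smul_smul]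

theorem pow_eq_one_of_apply_eq {c : Equiv.Perm ι} (hc : c ∈ σ.cycleFactorsFinset) {x : ι}
    (hx : x ∈ c.support) {θ : ℂ} (hθ : θ ^ c.support.card = 1) (p : ℕ) (hp : (σ ^ p) x = x) :
    θ ^ p = 1 := by
  obtain ⟨m, rfl⟩ := (pow_apply_eq_self_iff_card_dvd hc hx p).1 hp
  rw [pow_mul, hθ, one_pow]

theorem sign_eq_one_of_odd (h : ¬ Even (orderOf σ)) : sign σ = 1 := by
  have h1 : sign σ ^ orderOf σ = 1 := by rw [← map_pow, pow_orderOf_eq_one, map_one]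
  rcases Int.units_eq_one_or (sign σ) with h2 | h2
  · exact h2
  · rw [h2, (Nat.not_even_iff_odd.1 h).neg_one_pow] at h1
    exact absurd h1 (by decide)

theorem Lifts.hasEigenvalue_neg_of_sign (hΦ : CliffordRep Φ) (hG : Lifts Φ G σ)
    (hσ : sign σ = -1) {c : Equiv.Perm ι} (hc : c ∈ σ.cycleFactorsFinset)
    (hcard : c.support.card < Fintype.card ι) {μ : ℂ} (hμ : G.HasEigenvalue μ) :
    G.HasEigenvalue (-μ) := by
  let m : ℝ := c.support.card
  let N : ℝ := Fintype.card ι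
  have hm : 0 < m := Nat.cast_pos.2 (Finset.card_pos.2
    (mem_cycleFactorsFinset_iff.1 hc).1.nonempty_support)
  have hmN : m < N := Nat.cast_lt.2 hcard
  let u : ι → ℂ := fun i => if i ∈ c.support then ((N - m : ℝ) : ℂ) else ((-m : ℝ) : ℂ)
  have hcompl : ((c.supportᶜ.card : ℕ) : ℝ) = N - m := by
    rw [Finset.card_compl, Nat.cast_sub hcard.le]
  have hu : ∑ i, u i = 0 := by
    have : ∑ i, u i = ((m * (N - m) + (N - m) * (-m) : ℝ) : ℂ) := by
      rw [← Finset.sum_add_sum_compl c.support, Finset.sum_congr rfl fun i hi => if_pos hi,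
        Finset.sum_congr rfl fun i hi => if_neg (Finset.mem_compl.1 hi), Finset.sum_const,
        Finset.sum_const, nsmul_eq_mul, nsmul_eq_mul]
      push_cast [← hcompl]
      rfl
    rw [this]
    norm_num
    ring
  have huu : ∑ i, u i * u i ≠ 0 := by
    have : ∑ i, u i * u i = ((∑ i, if i ∈ c.support then (N - m) * (N - m) else m * m : ℝ) : ℂ) := by
      push_cast
      refine Finset.sum_congr rfl fun i _ => ?_
      by_cases hi : i ∈ c.support
      · simp only [u, if_pos hi]; push_cast; ring
      · simp only [u, if_neg hi]; push_cast; ring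
    rw [this, Complex.ofReal_ne_zero]
    have : Nonempty ι := ⟨(mem_cycleFactorsFinset_iff.1 hc).1.nonempty_support.choose⟩
    refine (Finset.sum_pos (fun i _ => ?_) Finset.univ_nonempty).ne'
    have := sub_pos.2 hmN
    split_ifs <;> positivity
  have hinv (i : ι) : u (σ⁻¹ i) = 1 * u i := by
    have h1 := zpow_apply_mem_support_of_mem_cycleFactorsFinset_iff (c := ⟨c, hc⟩) (x := i) (m := -1)
    rw [zpow_neg_one] at h1
    simp only [u, h1, one_mul]
  have h1 := hG.mul_map hu hinv
  rw [hσ] at h1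
  have h2 : G * Φ u = -(Φ u * G) := by rw [h1]; simp
  exact hasEigenvalue_neg huu (hΦ.anticomm _ _ hu hu) h2 h2 hμ

theorem exists_even_card (h : Even (orderOf σ)) :
    ∃ c ∈ σ.cycleFactorsFinset, Even c.support.card := by
  by_contra! hcon
  obtain ⟨m, hm⟩ := h
  rw [← two_mul] at hm
  have h1 : orderOf σ ∣ m := orderOf_dvd_iff_card_dvd.2 fun c hc => by
    have h2 := card_dvd_orderOf hc
    rw [hm] at h2
    exact (Nat.coprime_two_right.2 (Nat.not_even_iff_odd.1 (hcon c hc))).dvd_of_dvd_mul_left h2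
  have h3 := orderOf_pos σ
  have := Nat.le_of_dvd (by omega) h1
  omega

theorem Lifts.hasEigenvalue_neg (hΦ : CliffordRep Φ) (hG : Lifts Φ G σ)
    (hσ : Even (orderOf σ)) {c : Equiv.Perm ι} (hc : c ∈ σ.cycleFactorsFinset)
    (hcard : c.support.card < Fintype.card ι) {μ : ℂ} (hμ : G.HasEigenvalue μ) :
    G.HasEigenvalue (-μ) := by
  rcases Int.units_eq_one_or (sign σ) with h | h
  · obtain ⟨d, hd, hdcard⟩ := exists_even_card hσ
    obtain ⟨x, hx⟩ := (mem_cycleFactorsFinset_iff.1 hd).1.nonempty_support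
    have hθ := pow_eq_one_of_apply_eq hd hx hdcard.neg_one_pow
    have hsum := sum_eigenfun hθ (by norm_num)
    have h1 := hG.mul_map hsum (eigenfun_inv_apply hθ)
    have hne := sum_eigenfun_mul_inv_ne_zero hθ
    have h2 : ((-1 : ℂ))⁻¹ = -1 := by norm_num
    rw [h2] at hne h1
    have h3 : G * Φ (eigenfun σ x (-1)) = -(Φ (eigenfun σ x (-1)) * G) := by
      rw [h1, h]; simp
    exact _root_.hasEigenvalue_neg hne (hΦ.anticomm _ _ hsum hsum) h3 h3 hμ
  · exact hG.hasEigenvalue_neg_of_sign hΦ h hc hcard hμ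

/-- The standard primitive root of unity of order `l`. -/
noncomputable def zeta (l : ℕ) : ℂ := Complex.exp (2 * Real.pi * Complex.I / l)

theorem isPrimitiveRoot_zeta {l : ℕ} (hl : l ≠ 0) : IsPrimitiveRoot (zeta l) l :=
  Complex.isPrimitiveRoot_exp l hl

theorem Lifts.exists_eigenvalue [FiniteDimensional ℂ V] [Nontrivial V] (hΦ : CliffordRep Φ)
    (hG : Lifts Φ G σ) {c : Equiv.Perm ι} (hc : c ∈ σ.cycleFactorsFinset)
    (hcard : c.support.card < Fintype.card ι) :
    ∃ μ : ℂ, ∀ S ⊆ σ.cycleFactorsFinset.sigma fun c => Finset.Icc 1 ((c.support.card - 1) / 2),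
      ∀ δ : ℂ, δ = 1 ∨ δ = -1 ∧ Even (orderOf σ) →
        G.HasEigenvalue (μ * (δ * ∏ p ∈ S, zeta p.1.support.card ^ p.2)) := by
  have : Nonempty ι := ⟨(mem_cycleFactorsFinset_iff.1 hc).1.nonempty_support.choose⟩
  obtain ⟨x, hx⟩ : ∃ x : Equiv.Perm ι → ι, ∀ c ∈ σ.cycleFactorsFinset, x c ∈ c.support := by
    classical
    refine ⟨fun c => if h : c.support.Nonempty then h.choose else Classical.arbitrary ι,
      fun c hc => ?_⟩
    have h := (mem_cycleFactorsFinset_iff.1 hc).1.nonempty_support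
    simp only [dif_pos h]
    exact h.choose_spec
  set χ : ℂ := ((sign σ : ℤ) : ℂ) with hχ
  have hχ1 : χ = 1 ∨ χ = -1 := by
    rcases Int.units_eq_one_or (sign σ) with h | h <;> simp [hχ, h]
  set J := σ.cycleFactorsFinset.sigma fun c => Finset.Icc 1 ((c.support.card - 1) / 2) with hJ
  let θ : (_ : Equiv.Perm ι) × ℕ → ℂ := fun p => zeta p.1.support.card ^ p.2
  have hprim {p : (_ : Equiv.Perm ι) × ℕ} (hp : p ∈ J) :
      IsPrimitiveRoot (zeta p.1.support.card) p.1.support.card := by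
    refine isPrimitiveRoot_zeta (Finset.card_ne_zero.2 ⟨x p.1, hx _ (Finset.mem_sigma.1 hp).1⟩)
  have hθ {p : (_ : Equiv.Perm ι) × ℕ} (hp : p ∈ J) :
      ∀ q : ℕ, (σ ^ q) (x p.1) = x p.1 → θ p ^ q = 1 :=
    pow_eq_one_of_apply_eq (Finset.mem_sigma.1 hp).1 (hx _ (Finset.mem_sigma.1 hp).1)
      (by rw [← pow_mul, mul_comm, pow_mul, (hprim hp).pow_eq_one, one_pow])
  have hθ' {p : (_ : Equiv.Perm ι) × ℕ} (hp : p ∈ J) :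
      ∀ q : ℕ, (σ ^ q) (x p.1) = x p.1 → (θ p)⁻¹ ^ q = 1 := fun q hq => by
    rw [inv_pow, hθ hp q hq, inv_one]
  have hθ1 {p : (_ : Equiv.Perm ι) × ℕ} (hp : p ∈ J) : θ p ≠ 1 := fun h => by
    have h1 := Finset.mem_Icc.1 (Finset.mem_sigma.1 hp).2
    have := Nat.le_of_dvd (by omega) ((hprim hp).dvd_of_pow_eq_one _ h)
    omega
  have hθ0 {p : (_ : Equiv.Perm ι) × ℕ} (hp : p ∈ J) : θ p ≠ 0 := ne_zero_of_forall_pow (hθ hp)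
  have hsum {p} (hp : p ∈ J) := sum_eigenfun (hθ hp) (hθ1 hp)
  have hsum' {p} (hp : p ∈ J) := sum_eigenfun (hθ' hp) (inv_ne_one.2 (hθ1 hp))
  have hcyc {p q : (_ : Equiv.Perm ι) × ℕ} (hp : p ∈ J) (hq : q ∈ J)
      (h : σ.SameCycle (x p.1) (x q.1)) : p.1 = q.1 := by
    have h1 := Finset.mem_sigma.1 hp
    have h2 := Finset.mem_sigma.1 hq
    rw [cycle_is_cycleOf (hx _ h1.1) h1.1, cycle_is_cycleOf (hx _ h2.1) h2.1, h.cycleOf_eq]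
  obtain ⟨μ, hμ⟩ := exists_eigenvalue_mul_prod (J := J) (G := G)
    (a := fun p => Φ (eigenfun σ (x p.1) (θ p)⁻¹)) (b := fun p => Φ (eigenfun σ (x p.1) (θ p)))
    (α := fun p => χ * θ p) (β := fun p => χ * (θ p)⁻¹)
    (c := fun p => ∑ i, eigenfun σ (x p.1) (θ p)⁻¹ i * eigenfun σ (x p.1) (θ p) i)
    (fun p hp q hq => by
      rw [hΦ.anticomm _ _ (hsum hp) (hsum hq), sum_eigenfun_mul (hθ hp) (hθ hq), zero_smul]
      intro h
      obtain ⟨d, j⟩ := p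
      obtain ⟨d', j'⟩ := q
      obtain rfl : d = d' := hcyc hp hq h
      have h1 := Finset.mem_Icc.1 (Finset.mem_sigma.1 hp).2
      have h2 := Finset.mem_Icc.1 (Finset.mem_sigma.1 hq).2
      simp only [θ, ← pow_add]
      intro h3
      simp only at h1 h2
      have := Nat.le_of_dvd (by omega) ((hprim hp).dvd_of_pow_eq_one _ h3)
      simp only at this
      omega)
    (fun p hp q hq hpq => by
      rw [hΦ.anticomm _ _ (hsum' hp) (hsum hq), sum_eigenfun_mul (hθ' hp) (hθ hq), zero_smul]
      intro h h3
      obtain ⟨d, j⟩ := p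
      obtain ⟨d', j'⟩ := q
      obtain rfl : d = d' := hcyc hp hq h
      have h1 := Finset.mem_Icc.1 (Finset.mem_sigma.1 hp).2
      have h2 := Finset.mem_Icc.1 (Finset.mem_sigma.1 hq).2
      rw [inv_mul_eq_one₀ (hθ0 hp)] at h3
      simp only at h1 h2
      have := (hprim hp).pow_inj (by simp only; omega) (by simp only; omega) h3
      exact hpq (congrArg (Sigma.mk d) this))
    (fun p hp => hΦ.anticomm _ _ (hsum' hp) (hsum hp))
    (fun p hp => by
      have := sum_eigenfun_mul_inv_ne_zero (hθ' hp)
      rwa [inv_inv] at this)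
    (fun p hp => by
      have := hG.mul_map (hsum' hp) (eigenfun_inv_apply (hθ' hp))
      rwa [inv_inv] at this)
    (fun p hp => hG.mul_map (hsum hp) (eigenfun_inv_apply (hθ hp)))
    (fun p hp => mul_ne_zero (by rcases hχ1 with h | h <;> simp [h]) (inv_ne_zero (hθ0 hp)))
  refine ⟨μ, fun S hS δ hδ => ?_⟩
  have h1 := hμ S hS
  rw [Finset.prod_mul_distrib, Finset.prod_const] at h1
  by_cases heven : Even (orderOf σ)
  · have key : δ = χ ^ S.card ∨ δ = -χ ^ S.card := by
      have : χ ^ S.card = 1 ∨ χ ^ S.card = -1 := by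
        rcases hχ1 with h | h
        · simp [h]
        · rw [h]; exact neg_one_pow_eq_or ℂ _
      rcases this with h | h <;> rcases hδ with rfl | ⟨rfl, -⟩ <;> simp [h]
    rcases key with rfl | rfl
    · exact h1
    · convert hG.hasEigenvalue_neg hΦ heven hc hcard h1 using 1
      ring
  · have h2 : χ = 1 := by simp [hχ, sign_eq_one_of_odd heven]
    have h3 : δ = 1 := hδ.resolve_right fun h => heven h.2
    rw [h2, one_pow] at h1
    rw [h3]
    exact h1

end CliffordRep

end

section

open CliffordRep

/-- `η` is, up to an allowed sign, a product of distinct elements of the families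
`zeta (l c) ^ j`, `1 ≤ j ≤ (l c - 1) / 2`, with `c ∈ A`. -/
def Reachable {β : Type*} (E : Prop) (l : β → ℕ) (A : Finset β) (η : ℂ) : Prop :=
  ∃ S ⊆ A.sigma fun c => Finset.Icc 1 ((l c - 1) / 2), ∃ δ : ℂ, (δ = 1 ∨ δ = -1 ∧ E) ∧
    η = δ * ∏ p ∈ S, zeta (l p.1) ^ p.2

theorem exists_subset_sum_eq : ∀ {m M : ℕ}, 2 * M ≤ m * (m + 1) →
    ∃ S ⊆ Finset.Icc 1 m, ∑ j ∈ S, j = M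
  | 0, M, h => ⟨∅, by simp, by simp; omega⟩
  | m + 1, M, h => by
    have hmono := Finset.Icc_subset_Icc_right (a := 1) (Nat.le_add_right m 1)
    by_cases hM : 2 * M ≤ m * (m + 1)
    · obtain ⟨S, hS, hsum⟩ := exists_subset_sum_eq hM
      exact ⟨S, hS.trans hmono, hsum⟩
    · have h1 : m + 1 ≤ M := by
        by_contra h2
        rcases Nat.lt_or_ge m 1 with hm | hm
        · interval_cases m; omega
        · nlinarith
      obtain ⟨S, hS, hsum⟩ := exists_subset_sum_eq (m := m) (M := M - (m + 1)) (by
        zify [h1]; nlinarith)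
      have hnot : m + 1 ∉ S := fun h => by
        have := Finset.mem_Icc.1 (hS h)
        omega
      refine ⟨insert (m + 1) S, Finset.insert_subset (by simp) (hS.trans hmono), ?_⟩
      rw [Finset.sum_insert hnot, hsum]
      omega

theorem exists_pow_eq_one_mul {a b : ℕ} (ha : a ≠ 0) {η : ℂ} (hη : η ^ Nat.lcm a b = 1) :
    ∃ x y : ℂ, x ^ a = 1 ∧ y ^ b = 1 ∧ η = x * y := by
  rcases eq_or_ne b 0 with rfl | hb
  · exact ⟨1, η, one_pow a, pow_zero η, (one_mul η).symm⟩
  have hη0 : η ≠ 0 := by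
    rintro rfl
    rw [zero_pow (Nat.lcm_ne_zero ha hb)] at hη
    exact zero_ne_one hη
  obtain ⟨d, a', b', hd, hcop, rfl, rfl⟩ := Nat.exists_coprime' (m := a) (n := b)
    (Nat.gcd_pos_of_pos_left b (Nat.pos_of_ne_zero ha))
  obtain ⟨s, t, hst⟩ := Nat.isCoprime_iff_coprime.2 hcop
  rw [Nat.lcm_mul_right, hcop.lcm_eq_mul] at hη
  refine ⟨η ^ (t * b'), η ^ (s * a'), ?_, ?_, ?_⟩
  · rw [← zpow_natCast, ← zpow_mul, show t * (b' : ℤ) * ((a' * d : ℕ) : ℤ) =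
      ((a' * b' * d : ℕ) : ℤ) * t by push_cast; ring, zpow_mul, zpow_natCast, hη, one_zpow]
  · rw [← zpow_natCast, ← zpow_mul, show s * (a' : ℤ) * ((b' * d : ℕ) : ℤ) =
      ((a' * b' * d : ℕ) : ℤ) * s by push_cast; ring, zpow_mul, zpow_natCast, hη, one_zpow]
  · rw [← zpow_add₀ hη0, add_comm, hst, zpow_one]

namespace Reachable

variable {β : Type*} {E : Prop} {l : β → ℕ} {A B : Finset β} {η η' : ℂ}

theorem mono (h : Reachable E l A η) (hAB : A ⊆ B) : Reachable E l B η := by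
  obtain ⟨S, hS, h⟩ := h
  exact ⟨S, hS.trans (Finset.sigma_mono hAB fun _ => le_rfl), h⟩

theorem mul [DecidableEq β] (h : Reachable E l A η) (h' : Reachable E l B η')
    (hAB : Disjoint A B) : Reachable E l (A ∪ B) (η * η') := by
  obtain ⟨S, hS, δ, hδ, rfl⟩ := h
  obtain ⟨S', hS', δ', hδ', rfl⟩ := h'
  have hdisj : Disjoint S S' := Finset.disjoint_left.2 fun p hp hp' =>
    Finset.disjoint_left.1 hAB (Finset.mem_sigma.1 (hS hp)).1 (Finset.mem_sigma.1 (hS' hp')).1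
  refine ⟨S ∪ S', Finset.union_subset
    (hS.trans (Finset.sigma_mono Finset.subset_union_left fun _ => le_rfl))
    (hS'.trans (Finset.sigma_mono Finset.subset_union_right fun _ => le_rfl)), δ * δ', ?_, ?_⟩
  · rcases hδ with rfl | ⟨rfl, hE⟩ <;> rcases hδ' with rfl | ⟨rfl, hE'⟩ <;> simp [*]
  · rw [Finset.prod_union hdisj]
    ring

theorem neg (h : Reachable E l A η) (hE : E) : Reachable E l A (-η) := by
  obtain ⟨S, hS, δ, hδ, rfl⟩ := h
  refine ⟨S, hS, -δ, ?_, by ring⟩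
  rcases hδ with rfl | ⟨rfl, -⟩ <;> simp [hE]

theorem empty : Reachable E l ∅ 1 := ⟨∅, by simp, 1, Or.inl rfl, by simp⟩

theorem zeta_pow {c : β} {m M : ℕ} (hm : (l c - 1) / 2 = m) (hM : 2 * M ≤ m * (m + 1)) :
    Reachable E l {c} (zeta (l c) ^ M) := by
  obtain ⟨S, hS, hsum⟩ := exists_subset_sum_eq hM
  refine ⟨S.map (Function.Embedding.sigmaMk c), ?_, 1, Or.inl rfl, ?_⟩
  · intro p hp
    obtain ⟨j, hj, rfl⟩ := Finset.mem_map.1 hp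
    exact Finset.mem_sigma.2 ⟨Finset.mem_singleton_self c, hm ▸ hS hj⟩
  · rw [Finset.prod_map, one_mul, ← hsum]
    exact (Finset.prod_pow_eq_pow_sum S (fun j => j) (zeta (l c))).symm

theorem of_pow_eq_one {c : β} (h0 : l c ≠ 0) (h3 : l c ≠ 3) (h5 : l c ≠ 5)
    (hE : Even (l c) → E) (hη : η ^ l c = 1) : Reachable E l {c} η := by
  have hprim := isPrimitiveRoot_zeta h0
  have : NeZero (l c) := ⟨h0⟩
  obtain ⟨M, hM, rfl⟩ := hprim.eq_pow_of_pow_eq_one hη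
  rcases Nat.even_or_odd' (l c) with ⟨m, hm | hm⟩
  · have hm' : (l c - 1) / 2 = m - 1 := by omega
    have key {M : ℕ} (hM : M < m) : Reachable E l {c} (zeta (l c) ^ M) := by
      obtain ⟨m, rfl⟩ : ∃ p, m = p + 1 := ⟨m - 1, by omega⟩
      refine zeta_pow hm' ?_
      rcases Nat.eq_zero_or_pos m with rfl | hm0
      · omega
      · rw [Nat.add_sub_cancel]; nlinarith
    by_cases hMm : M < m
    · exact key hMm
    · have hneg : zeta (l c) ^ m = -1 := by
        rw [hm] at hprim ⊢
        have h1 : zeta (2 * m) ^ m * zeta (2 * m) ^ m = 1 := by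
          rw [← pow_add, ← two_mul, hprim.pow_eq_one]
        exact (mul_self_eq_one_iff.1 h1).resolve_left
          (hprim.pow_ne_one_of_pos_of_lt (by omega) (by omega))
      rw [show M = m + (M - m) by omega, pow_add, hneg, neg_one_mul]
      exact (key (by omega)).neg (hE ⟨m, by omega⟩)
  · refine zeta_pow (m := m) (by omega) ?_
    rcases Nat.lt_or_ge m 3 with h | h
    · interval_cases m <;> omega
    · nlinarith

theorem of_pow_lcm_eq_one (hl : ∀ c ∈ A, l c ≠ 0 ∧ l c ≠ 3 ∧ l c ≠ 5 ∧ (Even (l c) → E))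
    (hη : η ^ A.lcm l = 1) : Reachable E l A η := by
  classical
  induction A using Finset.induction_on generalizing η with
  | empty =>
    rw [Finset.lcm_empty, pow_one] at hη
    rw [hη]
    exact empty
  | insert c A hc ih =>
    obtain ⟨h0, h3, h5, hE⟩ := hl c (Finset.mem_insert_self c A)
    rw [Finset.lcm_insert] at hη
    obtain ⟨x, y, hx, hy, rfl⟩ := exists_pow_eq_one_mul h0 hη
    exact (of_pow_eq_one h0 h3 h5 hE hx).mul
      (ih (fun d hd => hl d (Finset.mem_insert_of_mem hd)) hy) (Finset.disjoint_singleton_left.2 hc)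

theorem of_pow_three_eq_one [DecidableEq β] {c d : β} (hc : l c = 3) (hd : l d = 3) (hcd : c ≠ d)
    (hη : η ^ 3 = 1) : Reachable E l ({c} ∪ {d}) η := by
  obtain ⟨M, hM, rfl⟩ := (isPrimitiveRoot_zeta three_ne_zero).eq_pow_of_pow_eq_one hη
  have hc1 {M : ℕ} (hM : M ≤ 1) : Reachable E l {c} (zeta 3 ^ M) :=
    hc ▸ zeta_pow (m := 1) (by omega) (by omega)
  have hd1 {M : ℕ} (hM : M ≤ 1) : Reachable E l {d} (zeta 3 ^ M) :=
    hd ▸ zeta_pow (m := 1) (by omega) (by omega)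
  have := (hc1 (M := M / 2) (by omega)).mul (hd1 (M := M - M / 2) (by omega))
    (Finset.disjoint_singleton.2 hcd)
  rwa [← pow_add, show M / 2 + (M - M / 2) = M by omega] at this

theorem mul_zeta_five_pow [DecidableEq β] {C : Finset β} {c₅ : β} {r j : ℕ} (hc₅ : c₅ ∈ C)
    (hl₅ : l c₅ = 5) (h5 : ∀ c ∈ C, 5 ∣ l c → c = c₅) (hl : ∀ c ∈ C, l c ≠ 0)
    (hE : ∀ c ∈ C, Even (l c) → E) (h3 : ∀ c ∈ C, l c = 3 → ∃ d ∈ C, d ≠ c ∧ 3 ∣ l d)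
    (hr : ∀ N, (∀ c ∈ C, l c ∣ N) → 5 * r ∣ N) (hη : η ^ r = 1) (hj : j ≤ 3) :
    Reachable E l C (η * zeta 5 ^ j) := by
  set A := {c ∈ C | l c ≠ 3 ∧ c ≠ c₅} with hA
  have hAl : ∀ c ∈ A, l c ≠ 0 ∧ l c ≠ 3 ∧ l c ≠ 5 ∧ (Even (l c) → E) := fun c hc => by
    obtain ⟨h1, h2, h4⟩ := Finset.mem_filter.1 hc
    exact ⟨hl c h1, h2, fun h => h4 (h5 c h1 h.symm.dvd), hE c h1⟩
  have hc₅A : c₅ ∉ A := fun h => (Finset.mem_filter.1 h).2.2 rfl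
  have hfive : Reachable E l {c₅} (zeta 5 ^ j) :=
    hl₅ ▸ zeta_pow (m := 2) (by omega) (by omega)
  have hdvd {N : ℕ} (h1 : A.lcm l ∣ N) (h2 : (∃ c ∈ C, l c = 3) → 3 ∣ N) : r ∣ N := by
    refine Nat.dvd_of_mul_dvd_mul_left (by norm_num) (hr (5 * N) fun c hc => ?_)
    by_cases hcA : c ∈ A
    · exact ((Finset.dvd_lcm hcA).trans h1).mul_left 5
    · by_cases hc3 : l c = 3
      · exact hc3 ▸ (h2 ⟨c, hc, hc3⟩).mul_left 5
      · obtain rfl : c = c₅ := by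
          by_contra h
          exact hcA (Finset.mem_filter.2 ⟨hc, hc3, h⟩)
        rw [hl₅]
        exact dvd_mul_right 5 N
  have hAC : A ⊆ C := Finset.filter_subset _ _
  have hfiveC : {c₅} ⊆ C := Finset.singleton_subset_iff.2 hc₅
  by_cases hpair : ∃ c ∈ C, ∃ d ∈ C, l c = 3 ∧ l d = 3 ∧ c ≠ d
  · obtain ⟨c, hc, d, hd, hc3, hd3, hcd⟩ := hpair
    have hr' : η ^ Nat.lcm (A.lcm l) 3 = 1 := by
      obtain ⟨m, hm⟩ := hdvd (Nat.dvd_lcm_left (A.lcm l) 3) fun _ => Nat.dvd_lcm_right _ 3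
      rw [hm, pow_mul, hη, one_pow]
    obtain ⟨x, y, hx, hy, rfl⟩ := exists_pow_eq_one_mul
      (Finset.lcm_ne_zero_iff.2 fun c hc => (hAl c hc).1) hr'
    have hdisj : Disjoint A ({c} ∪ {d}) := by
      rw [Finset.disjoint_union_right, Finset.disjoint_singleton_right,
        Finset.disjoint_singleton_right]
      exact ⟨fun h => (hAl c h).2.1 hc3, fun h => (hAl d h).2.1 hd3⟩
    refine (((of_pow_lcm_eq_one hAl hx).mul (of_pow_three_eq_one hc3 hd3 hcd hy) hdisj).mul hfive
      ?_).mono ?_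
    · simp only [Finset.disjoint_singleton_right, Finset.mem_union, Finset.mem_singleton, not_or]
      refine ⟨hc₅A, ?_, ?_⟩ <;> rintro rfl <;> omega
    · exact Finset.union_subset (Finset.union_subset hAC (Finset.union_subset
        (Finset.singleton_subset_iff.2 hc) (Finset.singleton_subset_iff.2 hd))) hfiveC
  · have hr' : η ^ A.lcm l = 1 := by
      obtain ⟨m, hm⟩ := hdvd dvd_rfl fun ⟨c, hc, hc3⟩ => by
        obtain ⟨d, hd, hdc, hd3⟩ := h3 c hc hc3
        refine hd3.trans (Finset.dvd_lcm (Finset.mem_filter.2 ⟨hd, fun h => ?_, ?_⟩))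
        · exact hpair ⟨c, hc, d, hd, hc3, h, hdc.symm⟩
        · rintro rfl
          omega
      rw [hm, pow_mul, hη, one_pow]
    exact ((of_pow_lcm_eq_one hAl hr').mul hfive
      (Finset.disjoint_singleton_right.2 hc₅A)).mono (Finset.union_subset hAC hfiveC)

end Reachable

end

section

open Module Polynomial

open CliffordRep (zeta isPrimitiveRoot_zeta)

theorem minpoly_mul_eq_of_eigenvalues {V : Type*} [AddCommGroup V] [Module ℂ V]
    [FiniteDimensional ℂ V] {G : End ℂ V} {r : ℕ} (hr : r ≠ 0) {ε : ℂ} (hε : ε ^ 2 = 1)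
    (hG : G ^ (5 * r) = ε • 1) (hinj : ∀ v, (G ^ r) v = ε • v → v = 0)
    (heig : ∀ x : ℂ, x ^ (5 * r) = ε → x ^ r ≠ ε → G.HasEigenvalue x) :
    minpoly ℂ G * (X ^ r - C ε) = X ^ (5 * r) - C ε := by
  have hε0 : ε ≠ 0 := by rintro rfl; norm_num at hε
  have h5r : 5 * r ≠ 0 := by omega
  have hfac : (∑ i ∈ Finset.range 5, (X ^ r) ^ i * C ε ^ (5 - 1 - i)) * (X ^ r - C ε) =
      (X ^ (5 * r) - C ε : ℂ[X]) := by
    rw [(Commute.all _ _).geom_sum₂_mul, ← pow_mul', ← C_pow,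
      show ε ^ 5 = ε by linear_combination (ε ^ 3 + ε) * hε]
  have hmonic := minpoly.monic (Algebra.IsIntegral.isIntegral (R := ℂ) G)
  refine eq_of_monic_of_associated (hmonic.mul (monic_X_pow_sub_C _ hr))
    (monic_X_pow_sub_C _ h5r) (associated_of_dvd_dvd ?_ ?_)
  · rw [← hfac]
    refine mul_dvd_mul_right (minpoly.dvd _ _ ?_) _
    have h := congrArg (aeval G) hfac
    rw [mul_comm, map_mul] at h
    simp only [map_sub, map_pow, aeval_X, aeval_C, hG, Algebra.algebraMap_eq_smul_one,
      sub_self] at h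
    ext v
    refine hinj _ ?_
    have h1 := LinearMap.congr_fun h v
    rw [End.mul_apply, LinearMap.sub_apply, LinearMap.zero_apply, sub_eq_zero] at h1
    simpa [Finset.smul_sum] using h1
  · have hsep : (X ^ (5 * r) - C ε : ℂ[X]).Separable :=
      separable_X_pow_sub_C ε (by exact_mod_cast h5r) hε0
    refine (IsAlgClosed.splits _).dvd_of_roots_le_roots (monic_X_pow_sub_C _ h5r).ne_zero
      ((Multiset.le_iff_subset (nodup_roots hsep)).2 fun x hx => ?_)
    have hx : x ^ (5 * r) = ε := by
      simpa [sub_eq_zero] using (mem_roots'.1 hx).2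
    refine (mem_roots (hmonic.mul (monic_X_pow_sub_C _ hr)).ne_zero).2 (root_mul.2 ?_)
    by_cases h : x ^ r = ε
    · exact Or.inr (by simp [h])
    · exact Or.inl (End.isRoot_of_hasEigenvalue (heig x hx h))

theorem exists_eq_mul_zeta_five_pow {r : ℕ} (hr : ¬ 5 ∣ r) {ε μ x : ℂ} (hε : ε ^ 2 = 1)
    (hμ : ∀ j ≤ 3, (μ * zeta 5 ^ j) ^ (5 * r) = ε ∧ (μ * zeta 5 ^ j) ^ r ≠ ε)
    (hx : x ^ (5 * r) = ε) (hxr : x ^ r ≠ ε) :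
    ∃ j ≤ 3, ∃ η : ℂ, η ^ r = 1 ∧ x = μ * (η * zeta 5 ^ j) := by
  have hprim := isPrimitiveRoot_zeta (show 5 ≠ 0 by norm_num)
  have hε0 : ε ≠ 0 := by rintro rfl; norm_num at hε
  have key {y : ℂ} (hy : y ^ (5 * r) = ε) : ∃ a < 5, y ^ r = ε * zeta 5 ^ a := by
    obtain ⟨a, ha, h⟩ := hprim.eq_pow_of_pow_eq_one (ξ := ε * y ^ r) (by
      rw [mul_pow, ← pow_mul', hy]; linear_combination (ε ^ 4 + ε ^ 2 + 1) * hε)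
    exact ⟨a, ha, by rw [h]; linear_combination -y ^ r * hε⟩
  have hone (m : ℕ) : ε * zeta 5 ^ m = ε ↔ (m : ZMod 5) = 0 := by
    rw [mul_eq_left₀ hε0, hprim.pow_eq_one_iff_dvd, ZMod.natCast_eq_zero_iff]
  obtain ⟨a, -, ha⟩ := key (y := μ) (by simpa using (hμ 0 (by norm_num)).1)
  obtain ⟨b, -, hb⟩ := key hx
  have hpow (j : ℕ) : (μ * zeta 5 ^ j) ^ r = ε * zeta 5 ^ (a + r * j) := by
    rw [mul_pow, ha, ← pow_mul', pow_add, mul_assoc]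
  have hr' : (r : ZMod 5) ≠ 0 := by rwa [Ne, ZMod.natCast_eq_zero_iff]
  have hb' : (b : ZMod 5) ≠ 0 := by rwa [Ne, ← hone, ← hb]
  have hj (j : ℕ) (h : j ≤ 3) : (a + r * j : ZMod 5) ≠ 0 := by
    have h1 := (hμ j h).2
    rw [hpow, Ne, hone] at h1
    exact_mod_cast h1
  have hdec : ∀ a b r : ZMod 5, r ≠ 0 → b ≠ 0 → a ≠ 0 → a + r * 1 ≠ 0 → a + r * 2 ≠ 0 →
      a + r * 3 ≠ 0 → b = a ∨ b = a + r * 1 ∨ b = a + r * 2 ∨ b = a + r * 3 := by decide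
  obtain ⟨j, hj3, hab⟩ : ∃ j ≤ 3, (b : ZMod 5) = (a + r * j : ℕ) := by
    rcases hdec a b r hr' hb' (by simpa using hj 0) (by simpa using hj 1) (by simpa using hj 2)
      (by simpa using hj 3) with h | h | h | h
    exacts [⟨0, by simp, by simpa using h⟩, ⟨1, by simp, by simpa using h⟩,
      ⟨2, by simp, by simpa using h⟩, ⟨3, by simp, by simpa using h⟩]
  have heq : x ^ r = (μ * zeta 5 ^ j) ^ r := by
    have hmod : b % 5 = (a + r * j) % 5 := (ZMod.natCast_eq_natCast_iff _ _ _).1 hab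
    rw [hpow, hb, ← pow_mod_orderOf _ b, ← pow_mod_orderOf _ (a + r * j), ← hprim.eq_orderOf, hmod]
  have hr0 : r ≠ 0 := by rintro rfl; simp at hr
  have hne : μ * zeta 5 ^ j ≠ 0 := fun h => by
    have h1 := (hμ j hj3).1
    rw [h, zero_pow (by omega)] at h1
    exact hε0 h1.symm
  refine ⟨j, hj3, x / (μ * zeta 5 ^ j), ?_, ?_⟩
  · rw [div_pow, heq, div_self (pow_ne_zero _ hne)]
  · have h1 := left_ne_zero_of_mul hne
    have h2 := right_ne_zero_of_mul hne
    field_simp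

theorem Module.End.HasEigenvalue.pow_eq {V : Type*} [AddCommGroup V] [Module ℂ V]
    {G : End ℂ V} {x : ℂ} (h : G.HasEigenvalue x) {m : ℕ} {ε : ℂ} (hG : G ^ m = ε • 1) :
    x ^ m = ε := by
  obtain ⟨v, hv⟩ := h.exists_hasEigenvector
  have h1 := hv.pow_apply m
  rw [hG, LinearMap.smul_apply, End.one_apply] at h1
  exact (smul_left_injective ℂ hv.2 h1).symm

end

open Schur Polynomial in
/-- Theorem: for `n > 8`, `(ρ, V)` a basic spin representation of `S̃_n` (an irreducible
spin representation of dimension `2^⌊(n−1)/2⌋`) and `g ∈ S̃_n` such that 5 is a solitary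
part but 3 is not a solitary part of the cycle type of `π(g)`, one has `5 ∣ k` and the
minimal polynomial of `ρ(g)` is `(X^k − ε_g)/(X^{k/5} − ε_g)`, where `k` is the order of
`π(g)`. -/
theorem schur_basic_spin_minpoly_solitary_five (n : ℕ) (hn : 8 < n)
    (π : Cover n →* Equiv.Perm (Fin n))
    (hπt : ∀ i : Fin (n - 1), π (t n i) = adj n i)
    (hπz : π (z n) = 1)
    (g : Cover n) (k : ℕ) (hk : k = orderOf (π g))
    (h5 : SolitaryPart 5 (π g)) (h3 : ¬ SolitaryPart 3 (π g))
    (V : Type) [AddCommGroup V] [Module ℂ V] [FiniteDimensional ℂ V] [Nontrivial V]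
    (ρ : Cover n →* Module.End ℂ V)
    (hirr : ∀ U : Submodule ℂ V, (∀ h : Cover n, U.map (ρ h) ≤ U) → U = ⊥ ∨ U = ⊤)
    (hspin : ρ (z n) = -1)
    (hdim : Module.finrank ℂ V = 2 ^ ((n - 1) / 2))
    (ε : ℂ) (hε : (g ^ k = 1 ∧ ε = 1) ∨ (g ^ k = z n ∧ ε = -1)) :
    5 ∣ k ∧ minpoly ℂ (ρ g) * (X ^ (k / 5) - C ε) = X ^ k - C ε := by
  have hΦ := cliffordRep_gen (by omega) hspin hirr hdim
  have hG : CliffordRep.Lifts (IsSpin.clifford n (gen ρ)) (ρ g) (π g) := fun u hu =>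
    map_mul_clifford hspin hπt hπz hΦ g hu
  have hGk : ρ g ^ k = ε • 1 := by
    rw [← map_pow]
    rcases hε with ⟨h, rfl⟩ | ⟨h, rfl⟩
    · rw [h, map_one, one_smul]
    · rw [h, hspin, neg_smul, one_smul]
  have hε2 : ε ^ 2 = 1 := by
    rcases hε with ⟨-, rfl⟩ | ⟨-, rfl⟩ <;> norm_num
  obtain ⟨c₅, hc₅, hcard, huniq⟩ := solitaryPart_iff.1 h5
  obtain ⟨r, hkr⟩ : 5 ∣ orderOf (π g) := hcard ▸ Equiv.Perm.card_dvd_orderOf hc₅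
  obtain rfl : k = 5 * r := hk.trans hkr
  have hr0 : r ≠ 0 := by
    rintro rfl
    exact (orderOf_pos (π g)).ne' hkr
  rw [Nat.mul_div_cancel_left r (by norm_num)]
  refine ⟨dvd_mul_right _ _, ?_⟩
  have hothers : ∀ d ∈ (π g).cycleFactorsFinset, d ≠ c₅ → d.support.card ∣ r := fun d hd hne => by
    have h1 : Nat.Coprime d.support.card 5 := by
      rw [Nat.coprime_comm, Nat.Prime.coprime_iff_not_dvd (by norm_num)]
      exact fun h => hne (huniq d hd h)
    exact h1.dvd_of_dvd_mul_left (hkr ▸ Equiv.Perm.card_dvd_orderOf hd)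
  have hr5 : ¬ 5 ∣ r := fun h => by
    have h1 : orderOf (π g) ∣ r := Equiv.Perm.orderOf_dvd_iff_card_dvd.2 fun c hc => by
      rcases eq_or_ne c c₅ with rfl | hne
      exacts [hcard ▸ h, hothers c hc hne]
    have := Nat.le_of_dvd (Nat.pos_of_ne_zero hr0) h1
    omega
  have hord : orderOf (π g ^ r) = 5 := by
    rw [orderOf_pow_of_dvd hr0 (hkr ▸ dvd_mul_left _ _), hkr,
      Nat.mul_div_cancel _ (Nat.pos_of_ne_zero hr0)]
  obtain ⟨hcyc, hcyc5⟩ := Equiv.Perm.isCycle_pow_of_card_dvd (by norm_num) hcard hothers hord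
  have hinj (v : V) (hv : (ρ g ^ r) v = ε • v) : v = 0 :=
    (hG.pow r).eq_zero_of_five_cycle hΦ hdim hcyc hcyc5 hε2
      (by rw [← pow_mul', hGk]) (by rw [← map_pow ρ]; exact det_pow_four hspin _) hv
  have heig {x : ℂ} (hx : (ρ g).HasEigenvalue x) : x ^ (5 * r) = ε ∧ x ^ r ≠ ε := by
    refine ⟨hx.pow_eq hGk, fun h => ?_⟩
    obtain ⟨v, hv⟩ := hx.exists_hasEigenvector
    exact hv.2 (hinj v (by rw [hv.pow_apply, h]))
  obtain ⟨μ, hμ⟩ := hG.exists_eigenvalue hΦ hc₅ (by rw [hcard, Fintype.card_fin]; omega)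
  have hμ {η : ℂ} (hη : η ^ r = 1) {j : ℕ} (hj : j ≤ 3) :
      (ρ g).HasEigenvalue (μ * (η * CliffordRep.zeta 5 ^ j)) := by
    obtain ⟨S, hS, δ, hδ, h⟩ := Reachable.mul_zeta_five_pow (E := Even (orderOf (π g)))
      (l := fun c : Equiv.Perm (Fin n) => c.support.card) hc₅ hcard huniq
      (fun c hc h => by
        have := (Equiv.Perm.mem_cycleFactorsFinset_iff.1 hc).1.two_le_card_support
        omega)
      (fun c hc h => h.trans_dvd (Equiv.Perm.card_dvd_orderOf hc))
      (fun c hc h => by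
        by_contra! hcon
        exact h3 (solitaryPart_iff.2 ⟨c, hc, h, fun d hd h' => by
          by_contra hne
          exact hcon d hd hne h'⟩))
      (fun N hN => hkr ▸ Equiv.Perm.orderOf_dvd_iff_card_dvd.2 hN) hη hj
    rw [h]
    exact hμ S hS δ hδ
  refine minpoly_mul_eq_of_eigenvalues hr0 hε2 hGk hinj fun x hx hxr => ?_
  obtain ⟨j, hj, η, hη, rfl⟩ := exists_eq_mul_zeta_five_pow hr5 hε2
    (fun j hj => heig (by simpa using hμ (one_pow r) hj)) hx hxr
  exact hμ hη hj
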